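/- arXiv:2105.11396 — 11 statements merged into one kernel-verified Lean document; each statement's English description precedes it below -/
import Mathlib

section
/- Let A ∈ ℝ^{n×n} be symmetric with zero diagonal and no zero row, let δ_i := Σ_j |A_{ij}|, Δ := diag(δ_1,…,δ_n), M := Δ^{-1/2} A Δ^{-1/2}, and let ψ_1,…,ψ_n satisfy (A.1)–(A.4). If π > 0 satisfies π·λ_max(M) ≤ 1, then for every x ∈ ℝ^n with x ≠ 0 one has the strict Lyapunov decrease inequality ψ(x)^T(−Δx + πAψ(x)) < 0. -/
open Matrix Filter Set

/-- The eigenvalues of a real symmetric (Hermitian) matrix, sorted in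
nondecreasing order: `lambdaSorted M ⟨0,_⟩ = λ_1 ≤ … ≤ lambdaSorted M ⟨n-1,_⟩ = λ_n`.
Junk value `0` if `M` is not Hermitian. -/
noncomputable def lambdaSorted {n : ℕ} (M : Matrix (Fin n) (Fin n) ℝ) : Fin n → ℝ :=
  if hM : M.IsHermitian then hM.eigenvalues ∘ ⇑(Tuple.sort hM.eigenvalues) else 0

/-- The largest eigenvalue `λ_max = λ_n` of a real symmetric matrix. -/
noncomputable def lambdaMax {n : ℕ} (M : Matrix (Fin n) (Fin n) ℝ) : ℝ :=
  ⨆ i, lambdaSorted M i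

/-- The smallest eigenvalue `λ_min = λ_1` of a real symmetric matrix. -/
noncomputable def lambdaMin {n : ℕ} (M : Matrix (Fin n) (Fin n) ℝ) : ℝ :=
  ⨅ i, lambdaSorted M i

/-- Assumptions (A.1)–(A.4) on the nonlinearities `ψ_i`: continuously
differentiable, odd, monotone with unit slope at the origin, saturated at `±1`,
and sigmoidal (strictly convex for `x<0`, strictly concave for `x>0`). -/
structure IsSigmoid (ψ : ℝ → ℝ) : Prop where
  contDiff : ContDiff ℝ 1 ψ
  odd : ∀ y : ℝ, ψ (-y) = -ψ y
  deriv_pos : ∀ y : ℝ, 0 < deriv ψ y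
  deriv_zero : deriv ψ 0 = 1
  tendsto_atTop : Tendsto ψ atTop (nhds 1)
  tendsto_atBot : Tendsto ψ atBot (nhds (-1))
  strictConvexOn : StrictConvexOn ℝ (Iio (0:ℝ)) ψ
  strictConcaveOn : StrictConcaveOn ℝ (Ioi (0:ℝ)) ψ

/-- The value `±1` associated to a Boolean sign. -/
def signVal (b : Bool) : ℝ := if b then 1 else -1

/-- `max_{s ∈ {−1,1}^n} sᵀ H s`, which equals `n − 2ε(𝒢)` for the normalized
interaction matrix `H` of a signed graph with frustration index `ε(𝒢)`. -/
noncomputable def maxCut {n : ℕ} (H : Matrix (Fin n) (Fin n) ℝ) : ℝ :=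
  ⨆ s : Fin n → Bool, (fun i => signVal (s i)) ⬝ᵥ H.mulVec (fun i => signVal (s i))

/-- The sign function with `sgn 0 = 1`. -/
noncomputable def sgn (y : ℝ) : ℝ := if 0 ≤ y then 1 else -1

theorem aux_lt {f : ℝ → ℝ} (h : IsSigmoid f) {y : ℝ} (hy : 0 < y) : 0 < f y ∧ f y < y := by
  have hd : Differentiable ℝ f := h.contDiff.differentiable (by norm_num)
  have hc : Continuous (deriv f) := h.contDiff.continuous_deriv (by norm_num)
  have h0 : f 0 = 0 := by
    have := h.odd 0
    rw [neg_zero] at this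
    linarith
  have hanti := h.strictConcaveOn.strictAntiOn_deriv (fun x _ => hd x)
  obtain ⟨c, hcm, hce⟩ := exists_deriv_eq_slope f hy hd.continuous.continuousOn
    hd.differentiableOn
  have hc0 : 0 < c := hcm.1
  have hlim : Tendsto (deriv f) (nhdsWithin 0 (Ioi 0)) (nhds 1) := by
    have := (hc.tendsto 0).mono_left (nhdsWithin_le_nhds (s := Ioi (0:ℝ)))
    rwa [h.deriv_zero] at this
  have h2 : deriv f (c/2) ≤ 1 := by
    refine ge_of_tendsto hlim ?_
    filter_upwards [Ioo_mem_nhdsGT (half_pos hc0)] with t ht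
    exact (hanti ht.1 (half_pos hc0) ht.2).le
  have h3 : deriv f c < deriv f (c/2) := hanti (half_pos hc0) hc0 (by linarith)
  have h4 : f y = deriv f c * y := by
    rw [hce, h0, sub_zero, sub_zero, div_mul_cancel₀ _ hy.ne']
  have h5 := h.deriv_pos c
  constructor
  · rw [h4]
    positivity
  · rw [h4]
    nlinarith

theorem aux_sq {f : ℝ → ℝ} (h : IsSigmoid f) {y : ℝ} (hy : y ≠ 0) : f y ^ 2 < f y * y := by
  rcases lt_or_gt_of_ne hy with hy | hy
  · obtain ⟨h1, h2⟩ := aux_lt h (neg_pos.mpr hy)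
    rw [h.odd] at h1 h2
    nlinarith
  · obtain ⟨h1, h2⟩ := aux_lt h hy
    nlinarith

theorem aux_zero {f : ℝ → ℝ} (h : IsSigmoid f) : f 0 = 0 := by
  have := h.odd 0
  rw [neg_zero] at this
  linarith

theorem aux_quad {n : ℕ} (M : Matrix (Fin n) (Fin n) ℝ) (hM : M.IsHermitian) (z : Fin n → ℝ) :
    z ⬝ᵥ M.mulVec z ≤ lambdaMax M * ∑ i, z i ^ 2 := by
  have hl : ∀ i, hM.eigenvalues i ≤ lambdaMax M := by
    intro i
    have : hM.eigenvalues i = lambdaSorted M ((Tuple.sort hM.eigenvalues).symm i) := by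
      rw [lambdaSorted, dif_pos hM, Function.comp_apply, Equiv.apply_symm_apply]
    rw [this]
    exact le_ciSup (Set.finite_range (lambdaSorted M)).bddAbove _
  set b := hM.eigenvectorBasis
  set Z : EuclideanSpace ℝ (Fin n) := WithLp.toLp 2 z with hZ
  have key : ∀ i, inner ℝ (b i) (WithLp.toLp 2 (M.mulVec z)) =
      hM.eigenvalues i * inner ℝ (b i) Z := by
    intro i
    have h1 := hM.mulVec_eigenvectorBasis i
    have hT : Mᵀ = M := by simpa [Matrix.IsHermitian] using hM
    have h2 : M.mulVec z ⬝ᵥ ⇑(b i) = hM.eigenvalues i * (z ⬝ᵥ ⇑(b i)) := by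
      rw [dotProduct_comm, Matrix.dotProduct_mulVec, ← Matrix.mulVec_transpose, hT, h1,
        smul_dotProduct, smul_eq_mul, dotProduct_comm z]
    simpa [EuclideanSpace.inner_eq_star_dotProduct] using h2
  have e1 : z ⬝ᵥ M.mulVec z = inner ℝ Z (WithLp.toLp 2 (M.mulVec z)) := by
    simp [EuclideanSpace.inner_eq_star_dotProduct, hZ, dotProduct_comm]
  have e2 : ∑ i, z i ^ 2 = inner ℝ Z Z := by
    rw [EuclideanSpace.inner_eq_star_dotProduct]
    simp [hZ, dotProduct, sq]
  rw [e1, e2, ← b.sum_inner_mul_inner, ← b.sum_inner_mul_inner Z Z, Finset.mul_sum]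
  refine Finset.sum_le_sum fun i _ => ?_
  rw [key, real_inner_comm]
  nlinarith [hl i, mul_nonneg (sub_nonneg.mpr (hl i)) (mul_self_nonneg (inner ℝ (b i) Z))]

/-- if `π·λ_max(M) ≤ 1`, the Lyapunov function `V(x) = Σ_i ∫_0^{x_i} ψ_i`
strictly decreases along `ẋ = −Δx + πAψ(x)`: `ψ(x)ᵀ(−Δx + πAψ(x)) < 0` for `x ≠ 0`. -/
theorem stmt_0 {n : ℕ} (hn : 2 ≤ n)
    (A : Matrix (Fin n) (Fin n) ℝ) (hA : A.IsSymm)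
    (hdiag : ∀ i, A i i = 0) (hrow : ∀ i, ∃ j, A i j ≠ 0)
    (δ : Fin n → ℝ) (hδ : ∀ i, δ i = ∑ j, |A i j|)
    (M : Matrix (Fin n) (Fin n) ℝ)
    (hM : M = Matrix.diagonal (fun i => (Real.sqrt (δ i))⁻¹) * A *
      Matrix.diagonal (fun i => (Real.sqrt (δ i))⁻¹))
    (ψ : Fin n → ℝ → ℝ) (hψ : ∀ i, IsSigmoid (ψ i))
    (p : ℝ) (hp : 0 < p) (hp1 : p * lambdaMax M ≤ 1) :
    ∀ x : Fin n → ℝ, x ≠ 0 →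
      (fun i => ψ i (x i)) ⬝ᵥ
        (-((Matrix.diagonal δ).mulVec x) + p • A.mulVec (fun i => ψ i (x i))) < 0 := by
  intro x hx
  have hpos : ∀ i, 0 < δ i := by
    intro i
    obtain ⟨j, hj⟩ := hrow i
    rw [hδ]
    exact Finset.sum_pos' (fun _ _ => abs_nonneg _) ⟨j, Finset.mem_univ _, abs_pos.mpr hj⟩
  have hs : ∀ i, Real.sqrt (δ i) ≠ 0 := fun i => (Real.sqrt_pos.mpr (hpos i)).ne'
  have hMe : ∀ i j, M i j = (Real.sqrt (δ i))⁻¹ * A i j * (Real.sqrt (δ j))⁻¹ := by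
    intro i j
    rw [hM, Matrix.mul_diagonal, Matrix.diagonal_mul]
  have hH : M.IsHermitian := by
    ext i j
    rw [Matrix.conjTranspose_apply, hMe, hMe, hA.apply]
    simp only [star_trivial]
    ring
  have hq := aux_quad M hH (fun i => Real.sqrt (δ i) * ψ i (x i))
  have e1 : (fun i => Real.sqrt (δ i) * ψ i (x i)) ⬝ᵥ
      M.mulVec (fun i => Real.sqrt (δ i) * ψ i (x i)) =
      (fun i => ψ i (x i)) ⬝ᵥ A.mulVec (fun i => ψ i (x i)) := by
    simp only [dotProduct, Matrix.mulVec, Finset.mul_sum, hMe]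
    refine Finset.sum_congr rfl fun i _ => Finset.sum_congr rfl fun j _ => ?_
    have := hs i
    have := hs j
    field_simp
  have e2 : ∑ i, (Real.sqrt (δ i) * ψ i (x i)) ^ 2 = ∑ i, δ i * ψ i (x i) ^ 2 := by
    refine Finset.sum_congr rfl fun i _ => ?_
    rw [mul_pow, Real.sq_sqrt (hpos i).le]
  rw [e1, e2] at hq
  have hS : 0 ≤ ∑ i, δ i * ψ i (x i) ^ 2 :=
    Finset.sum_nonneg fun i _ => mul_nonneg (hpos i).le (sq_nonneg _)
  have hlt : ∑ i, δ i * ψ i (x i) ^ 2 < ∑ i, ψ i (x i) * (δ i * x i) := by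
    obtain ⟨k, hk⟩ := Function.ne_iff.mp hx
    refine Finset.sum_lt_sum (fun i _ => ?_) ⟨k, Finset.mem_univ _, ?_⟩
    · by_cases hi : x i = 0
      · simp [hi, aux_zero (hψ i)]
      · nlinarith [mul_lt_mul_of_pos_left (aux_sq (hψ i) hi) (hpos i)]
    · nlinarith [mul_lt_mul_of_pos_left (aux_sq (hψ k) hk) (hpos k)]
  have e3 : (fun i => ψ i (x i)) ⬝ᵥ ((Matrix.diagonal δ).mulVec x) =
      ∑ i, ψ i (x i) * (δ i * x i) := by
    simp [dotProduct, Matrix.mulVec_diagonal]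
  rw [dotProduct_add, dotProduct_neg, dotProduct_smul, smul_eq_mul, e3]
  have h1 := mul_le_mul_of_nonneg_left hq hp.le
  have h2 := mul_le_mul_of_nonneg_right hp1 hS
  linarith
end

section
/- Let A ∈ ℝ^{n×n} be symmetric with zero diagonal and no zero row, let δ_i := Σ_j |A_{ij}|, Δ := diag(δ_1,…,δ_n), M := Δ^{-1/2} A Δ^{-1/2}, and let ψ_1,…,ψ_n satisfy (A.1)–(A.4). If π > 0 satisfies π·λ_max(M) ≤ 1, then the only solution x ∈ ℝ^n of the equilibrium equation Δx = πAψ(x) is x = 0. -/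
open Matrix Filter Set

lemma IsSigmoid.deriv_lt_one {f : ℝ → ℝ} (hf : IsSigmoid f) {c : ℝ} (hc : 0 < c) :
    deriv f c < 1 := by
  have hd : Differentiable ℝ f := hf.contDiff.differentiable (by norm_num)
  have hanti : StrictAntiOn (deriv f) (Ioi 0) :=
    hf.strictConcaveOn.strictAntiOn_deriv (fun x _ => hd x)
  have hcont : Continuous (deriv f) := hf.contDiff.continuous_deriv (by norm_num)
  have h1 : deriv f c < deriv f (c / 2) :=
    hanti (by simpa using hc) (by simpa using hc) (by linarith)
  have h2 : deriv f (c / 2) ≤ 1 := by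
    have ht : Tendsto (deriv f) (nhdsWithin 0 (Ioi 0)) (nhds 1) := by
      have := hcont.tendsto 0
      rw [hf.deriv_zero] at this
      exact this.mono_left nhdsWithin_le_nhds
    refine ge_of_tendsto ht ?_
    have : Ioo (0:ℝ) (c / 2) ∈ nhdsWithin (0:ℝ) (Ioi 0) := Ioo_mem_nhdsGT (by linarith)
    filter_upwards [this] with t ht
    exact (hanti ht.1 (by simpa using hc) ht.2).le
  linarith

lemma IsSigmoid.pos_aux {f : ℝ → ℝ} (hf : IsSigmoid f) {y : ℝ} (hy : 0 < y) :
    0 < f y ∧ f y < y := by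
  have hd : Differentiable ℝ f := hf.contDiff.differentiable (by norm_num)
  have h0 : f 0 = 0 := by
    have := hf.odd 0
    simp at this
    linarith
  obtain ⟨c, hc, h⟩ := exists_deriv_eq_slope f hy hd.continuous.continuousOn hd.differentiableOn
  have h1 := hf.deriv_lt_one hc.1
  have h2 := hf.deriv_pos c
  rw [h0, sub_zero, sub_zero] at h
  rw [h] at h1 h2
  constructor
  · by_contra hn
    exact absurd (div_nonpos_of_nonpos_of_nonneg (not_lt.mp hn) hy.le) (not_le.mpr h2)
  · rwa [div_lt_one hy] at h1

lemma IsSigmoid.mul_pos_aux {f : ℝ → ℝ} (hf : IsSigmoid f) {y : ℝ} (hy : y ≠ 0) :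
    0 < f y * (y - f y) := by
  rcases lt_or_gt_of_ne hy with h | h
  · obtain ⟨h1, h2⟩ := hf.pos_aux (neg_pos.mpr h)
    rw [hf.odd] at h1 h2
    nlinarith
  · obtain ⟨h1, h2⟩ := hf.pos_aux h
    exact mul_pos h1 (by linarith)

lemma rayleigh_aux {n : ℕ} (M : Matrix (Fin n) (Fin n) ℝ) (hM : M.IsHermitian) (w : Fin n → ℝ) :
    w ⬝ᵥ M *ᵥ w ≤ lambdaMax M * (w ⬝ᵥ w) := by
  have hle : ∀ i, hM.eigenvalues i ≤ lambdaMax M := by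
    intro i
    have h := le_ciSup (f := lambdaSorted M) (Set.finite_range _).bddAbove
      ((Tuple.sort hM.eigenvalues).symm i)
    have e : lambdaSorted M ((Tuple.sort hM.eigenvalues).symm i) = hM.eigenvalues i := by
      rw [lambdaSorted, dif_pos hM, Function.comp_apply, Equiv.apply_symm_apply]
    rw [e] at h
    exact h
  have hps : (lambdaMax M • (1 : Matrix (Fin n) (Fin n) ℝ) - M).PosSemidef := by
    have hd : (diagonal (fun i => lambdaMax M - hM.eigenvalues i)).PosSemidef := by
      rw [posSemidef_diagonal_iff]
      intro i
      exact sub_nonneg.mpr (hle i)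
    have h := hd.mul_mul_conjTranspose_same (hM.eigenvectorUnitary : Matrix (Fin n) (Fin n) ℝ)
    convert h using 1
    have hs := hM.spectral_theorem
    rw [Unitary.conjStarAlgAut_apply] at hs
    have hu : (hM.eigenvectorUnitary : Matrix (Fin n) (Fin n) ℝ) *
        star (hM.eigenvectorUnitary : Matrix (Fin n) (Fin n) ℝ) = 1 :=
      Unitary.coe_mul_star_self _
    have hdd : diagonal (fun i => lambdaMax M - hM.eigenvalues i) =
        lambdaMax M • (1 : Matrix (Fin n) (Fin n) ℝ) -
          Matrix.diagonal (RCLike.ofReal ∘ hM.eigenvalues) := by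
      rw [smul_one_eq_diagonal, diagonal_sub]
      rfl
    rw [hdd, mul_sub, sub_mul, ← star_eq_conjTranspose, ← hs]
    simp [hu]
  have h := hps.dotProduct_mulVec_nonneg w
  simp only [star_trivial, sub_mulVec, smul_mulVec, one_mulVec, dotProduct_sub, dotProduct_smul,
    smul_eq_mul] at h
  linarith

/-- if `π·λ_max(M) ≤ 1`, the only solution of the equilibrium
equation `Δx = πAψ(x)` is `x = 0`. -/
theorem stmt_1 {n : ℕ} (hn : 2 ≤ n)
    (A : Matrix (Fin n) (Fin n) ℝ) (hA : A.IsSymm)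
    (hdiag : ∀ i, A i i = 0) (hrow : ∀ i, ∃ j, A i j ≠ 0)
    (δ : Fin n → ℝ) (hδ : ∀ i, δ i = ∑ j, |A i j|)
    (M : Matrix (Fin n) (Fin n) ℝ)
    (hM : M = Matrix.diagonal (fun i => (Real.sqrt (δ i))⁻¹) * A *
      Matrix.diagonal (fun i => (Real.sqrt (δ i))⁻¹))
    (ψ : Fin n → ℝ → ℝ) (hψ : ∀ i, IsSigmoid (ψ i))
    (p : ℝ) (hp : 0 < p) (hp1 : p * lambdaMax M ≤ 1) :
    ∀ x : Fin n → ℝ,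
      (Matrix.diagonal δ).mulVec x = p • A.mulVec (fun i => ψ i (x i)) → x = 0 := by
  intro x hx
  have hδpos : ∀ i, 0 < δ i := by
    intro i
    rw [hδ]
    obtain ⟨j, hj⟩ := hrow i
    exact Finset.sum_pos' (fun _ _ => abs_nonneg _) ⟨j, Finset.mem_univ _, abs_pos.mpr hj⟩
  have hMij : ∀ i j, M i j = (Real.sqrt (δ i))⁻¹ * A i j * (Real.sqrt (δ j))⁻¹ := by
    intro i j
    rw [hM, mul_diagonal, diagonal_mul]
  have hMH : M.IsHermitian := by
    ext i j
    rw [conjTranspose_apply, star_trivial, hMij, hMij, hA.apply i j]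
    ring
  have hs : ∀ i, Real.sqrt (δ i) ≠ 0 := fun i => (Real.sqrt_pos.mpr (hδpos i)).ne'
  have hR := rayleigh_aux M hMH (fun i => Real.sqrt (δ i) * ψ i (x i))
  have e1 : (fun i => Real.sqrt (δ i) * ψ i (x i)) ⬝ᵥ
      M *ᵥ (fun i => Real.sqrt (δ i) * ψ i (x i)) =
      ∑ i, ψ i (x i) * ∑ j, A i j * ψ j (x j) := by
    simp only [dotProduct, mulVec, Finset.mul_sum]
    refine Finset.sum_congr rfl fun i _ => Finset.sum_congr rfl fun j _ => ?_
    rw [hMij]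
    have := hs i
    have := hs j
    field_simp
  have e2 : (fun i => Real.sqrt (δ i) * ψ i (x i)) ⬝ᵥ
      (fun i => Real.sqrt (δ i) * ψ i (x i)) = ∑ i, δ i * ψ i (x i) ^ 2 := by
    simp only [dotProduct]
    refine Finset.sum_congr rfl fun i _ => ?_
    have := Real.mul_self_sqrt (hδpos i).le
    linear_combination ψ i (x i) ^ 2 * this
  rw [e1, e2] at hR
  have hxi : ∀ i, δ i * x i = p * ∑ j, A i j * ψ j (x j) := by
    intro i
    have := congrFun hx i
    rw [mulVec_diagonal] at this
    simpa [mulVec, dotProduct] using this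
  have e3 : ∑ i, δ i * (ψ i (x i) * x i) = p * ∑ i, ψ i (x i) * ∑ j, A i j * ψ j (x j) := by
    rw [Finset.mul_sum]
    refine Finset.sum_congr rfl fun i _ => ?_
    linear_combination ψ i (x i) * hxi i
  have hS : 0 ≤ ∑ i, δ i * ψ i (x i) ^ 2 :=
    Finset.sum_nonneg fun i _ => mul_nonneg (hδpos i).le (sq_nonneg _)
  have h1 := mul_le_mul_of_nonneg_left hR hp.le
  have h2 := mul_le_mul_of_nonneg_right hp1 hS
  have hfin : ∑ i, δ i * (ψ i (x i) * (x i - ψ i (x i))) ≤ 0 := by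
    have : ∑ i, δ i * (ψ i (x i) * (x i - ψ i (x i))) =
        ∑ i, δ i * (ψ i (x i) * x i) - ∑ i, δ i * ψ i (x i) ^ 2 := by
      rw [← Finset.sum_sub_distrib]
      exact Finset.sum_congr rfl fun i _ => by ring
    rw [this, e3]
    linarith
  by_contra hne
  obtain ⟨k, hk⟩ := Function.ne_iff.mp hne
  have hnn : ∀ i, 0 ≤ δ i * (ψ i (x i) * (x i - ψ i (x i))) := by
    intro i
    refine mul_nonneg (hδpos i).le ?_
    by_cases h : x i = 0
    · have := (hψ i).odd 0
      simp at this
      have h0 : ψ i 0 = 0 := by linarith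
      simp [h, h0]
    · exact ((hψ i).mul_pos_aux h).le
  have : 0 < ∑ i, δ i * (ψ i (x i) * (x i - ψ i (x i))) :=
    Finset.sum_pos' (fun i _ => hnn i)
      ⟨k, Finset.mem_univ _, mul_pos (hδpos k) ((hψ k).mul_pos_aux hk)⟩
  linarith
end

section
/- Let A ∈ ℝ^{n×n} be symmetric with zero diagonal and no zero row, let δ_i := Σ_j |A_{ij}|, Δ := diag(δ_1,…,δ_n), and M := Δ^{-1/2} A Δ^{-1/2}. If π > 0 satisfies π·λ_max(M) > 1, then the symmetric matrix −Δ + πA has a strictly positive eigenvalue; hence the linearization at the origin of ẋ = −Δx + πAψ(x) is unstable. -/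
open Matrix Filter Set

/-- if `π·λ_max(M) > 1`, the symmetric matrix `−Δ + πA` has a
strictly positive eigenvalue (the linearization at the origin is unstable). -/
theorem stmt_2 {n : ℕ} (hn : 2 ≤ n)
    (A : Matrix (Fin n) (Fin n) ℝ) (hA : A.IsSymm)
    (hdiag : ∀ i, A i i = 0) (hrow : ∀ i, ∃ j, A i j ≠ 0)
    (δ : Fin n → ℝ) (hδ : ∀ i, δ i = ∑ j, |A i j|)
    (M : Matrix (Fin n) (Fin n) ℝ)
    (hM : M = Matrix.diagonal (fun i => (Real.sqrt (δ i))⁻¹) * A *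
      Matrix.diagonal (fun i => (Real.sqrt (δ i))⁻¹))
    (p : ℝ) (hp : 0 < p) (hp1 : 1 < p * lambdaMax M) :
    ∃ μ : ℝ, 0 < μ ∧ ∃ v : Fin n → ℝ, v ≠ 0 ∧
      (p • A - Matrix.diagonal δ).mulVec v = μ • v := by
  have hδ0 : ∀ i, 0 < δ i := by
    intro i
    obtain ⟨j, hj⟩ := hrow i
    rw [hδ i]
    exact Finset.sum_pos' (fun _ _ => abs_nonneg _) ⟨j, Finset.mem_univ j, abs_pos.mpr hj⟩
  have hMH : M.IsHermitian := by
    ext i j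
    have := hA.apply i j
    simp [hM, Matrix.mul_diagonal, Matrix.diagonal_mul, this]
    ring
  haveI : Nonempty (Fin n) := ⟨⟨0, by omega⟩⟩
  obtain ⟨k, hk⟩ : ∃ k, hMH.eigenvalues k = lambdaMax M := by
    obtain ⟨i, hi⟩ := exists_eq_ciSup_of_finite (f := lambdaSorted M)
    refine ⟨Tuple.sort hMH.eigenvalues i, ?_⟩
    rw [lambdaMax, ← hi, lambdaSorted, dif_pos hMH]
    rfl
  by_contra hcon
  push Not at hcon
  have hC : (Matrix.diagonal δ - p • A).IsHermitian := by
    ext i j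
    have := hA.apply i j
    by_cases h : i = j
    · subst h; simp
    · simp [Matrix.diagonal_apply_ne _ h, Matrix.diagonal_apply_ne _ (Ne.symm h), this]
  have hpsd : (Matrix.diagonal δ - p • A).PosSemidef := by
    rw [hC.posSemidef_iff_eigenvalues_nonneg]
    intro i
    by_contra hneg
    have hneg' : 0 < - hC.eigenvalues i := by
      simpa using hneg
    refine hcon _ hneg' (hC.eigenvectorBasis i).ofLp ?_ ?_
    · intro h
      apply hC.eigenvectorBasis.orthonormal.ne_zero i
      ext t
      exact congrFun h t
    · rw [← neg_sub, Matrix.neg_mulVec, hC.mulVec_eigenvectorBasis, neg_smul]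
  have h2 := hpsd.conjTranspose_mul_mul_same (Matrix.diagonal (fun i => (Real.sqrt (δ i))⁻¹))
  have h3 : (Matrix.diagonal (fun i => (Real.sqrt (δ i))⁻¹))ᴴ * (Matrix.diagonal δ - p • A) *
      Matrix.diagonal (fun i => (Real.sqrt (δ i))⁻¹) = 1 - p • M := by
    ext i j
    rw [hM, Matrix.diagonal_conjTranspose]
    have hs : Real.sqrt (δ i) ≠ 0 := (Real.sqrt_pos.mpr (hδ0 i)).ne'
    have hq : Real.sqrt (δ i) * Real.sqrt (δ i) = δ i := Real.mul_self_sqrt (hδ0 i).le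
    by_cases h : i = j
    · subst h
      simp [Matrix.mul_diagonal, Matrix.diagonal_mul, hdiag]
      field_simp
      nlinarith
    · simp [Matrix.mul_diagonal, Matrix.diagonal_mul, h]
      ring
  rw [h3] at h2
  have h4 := h2.dotProduct_mulVec_nonneg (hMH.eigenvectorBasis k).ofLp
  rw [Matrix.sub_mulVec, Matrix.one_mulVec, Matrix.smul_mulVec, hMH.mulVec_eigenvectorBasis, hk,
    smul_smul, dotProduct_sub, dotProduct_smul] at h4
  have h5 : 0 < star (hMH.eigenvectorBasis k).ofLp ⬝ᵥ (hMH.eigenvectorBasis k).ofLp := by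
    rw [Matrix.dotProduct_star_self_pos_iff]
    intro h
    apply hMH.eigenvectorBasis.orthonormal.ne_zero k
    ext t
    exact congrFun h t
  rw [smul_eq_mul] at h4
  nlinarith
end

section
/- Let A ∈ ℝ^{n×n} be symmetric with zero diagonal and no zero row, δ_i := Σ_j |A_{ij}|, Δ := diag(δ_1,…,δ_n), M := Δ^{-1/2} A Δ^{-1/2}, and let ψ_1,…,ψ_n satisfy (A.1)–(A.4). Assume the largest eigenvalue λ_n(M) is simple and π > 0 satisfies π·λ_{n−1}(M) < 1 < π·λ_n(M). If x* ≠ 0 satisfies Δx* = πAψ(x*), then, with Ψ := diag(ψ_1′(x*_1),…,ψ_n′(x*_n)), one has π·λ_max(Ψ^{1/2} M Ψ^{1/2}) < 1; consequently all eigenvalues of the Jacobian Δ(−I + πΔ^{-1}AΨ) are negative and x* is a locally asymptotically stable equilibrium of ẋ = −Δx + πAψ(x). -/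
open Matrix Filter Set

lemma aux_sig_pos {ψ : ℝ → ℝ} (h : IsSigmoid ψ) {x : ℝ} (hx : 0 < x) :
    ∃ d : ℝ, deriv ψ x < d ∧ d ≤ 1 ∧ ψ x = d * x := by
  have hd : Differentiable ℝ ψ := h.contDiff.differentiable (by norm_num)
  have h0 : ψ 0 = 0 := by
    have := h.odd 0
    simp at this
    linarith
  have hc : Continuous (deriv ψ) := h.contDiff.continuous_deriv (by norm_num)
  have ha : StrictAntiOn (deriv ψ) (Ioi 0) :=
    h.strictConcaveOn.strictAntiOn_deriv (fun x _ => hd x)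
  obtain ⟨c, hc1, hc2⟩ := exists_deriv_eq_slope ψ hx hd.continuous.continuousOn hd.differentiableOn
  refine ⟨deriv ψ c, ha hc1.1 hx hc1.2, ?_, ?_⟩
  · have ht : Tendsto (deriv ψ) (nhdsWithin 0 (Ioi 0)) (nhds 1) := by
      rw [← h.deriv_zero]
      exact hc.continuousAt.tendsto.mono_left nhdsWithin_le_nhds
    refine ge_of_tendsto ht ?_
    filter_upwards [Ioo_mem_nhdsGT hc1.1] with s hs
    exact (ha hs.1 hc1.1 hs.2).le
  · rw [hc2, h0, sub_zero, sub_zero]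
    field_simp

lemma aux_sig {ψ : ℝ → ℝ} (h : IsSigmoid ψ) (x : ℝ) :
    ∃ d : ℝ, deriv ψ x ≤ d ∧ (x ≠ 0 → deriv ψ x < d) ∧ d ≤ 1 ∧ ψ x = d * x := by
  rcases lt_trichotomy x 0 with hx | hx | hx
  · obtain ⟨d, h1, h2, h3⟩ := aux_sig_pos h (x := -x) (by linarith)
    have e : deriv ψ (-x) = deriv ψ x := by
      have h5 : (fun y => ψ (-y)) = fun y => - ψ y := funext h.odd
      have h6 := congrArg (fun g => deriv g x) h5
      simp only [deriv_comp_neg] at h6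
      rw [deriv.fun_neg] at h6
      linarith
    rw [e] at h1
    rw [h.odd] at h3
    exact ⟨d, h1.le, fun _ => h1, h2, by linarith⟩
  · subst hx
    refine ⟨1, h.deriv_zero.le, fun h => absurd rfl h, le_rfl, ?_⟩
    have := h.odd 0
    simp at this
    linarith
  · obtain ⟨d, h1, h2, h3⟩ := aux_sig_pos h hx
    exact ⟨d, h1.le, fun _ => h1, h2, h3⟩

lemma aux_core {n : ℕ} (A : Matrix (Fin n) (Fin n) ℝ) (hA : A.IsSymm) (p : ℝ)
    (δ e x a d z : Fin n → ℝ) (hδ : ∀ i, 0 < δ i)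
    (he : ∀ u : Fin n → ℝ, u ≠ 0 → e ⬝ᵥ u = 0 → p * (u ⬝ᵥ A *ᵥ u) < ∑ i, δ i * u i ^ 2)
    (ha : ∀ i, 0 < a i) (had : ∀ i, a i ≤ d i) (had' : ∀ i, x i ≠ 0 → a i < d i)
    (hd : ∀ i, d i ≤ 1) (hx : x ≠ 0) (hz : ∀ i, z i = d i * x i)
    (heq : ∀ i, δ i * x i = p * (A *ᵥ z) i) (w : Fin n → ℝ) (hw : w ≠ 0) :
    p * (w ⬝ᵥ A *ᵥ w) < ∑ i, δ i * w i ^ 2 / a i := by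
  have hdp : ∀ i, 0 < d i := fun i => (ha i).trans_le (had i)
  have m1 : ∀ u : Fin n → ℝ, ∑ i, δ i * u i ^ 2 ≤ ∑ i, δ i * u i ^ 2 / d i := by
    intro u
    refine Finset.sum_le_sum fun i _ => ?_
    exact le_div_self (mul_nonneg (hδ i).le (sq_nonneg _)) (hdp i) (hd i)
  have m2 : ∀ u : Fin n → ℝ, ∑ i, δ i * u i ^ 2 / d i ≤ ∑ i, δ i * u i ^ 2 / a i := by
    intro u
    refine Finset.sum_le_sum fun i _ => ?_
    exact div_le_div_of_nonneg_left (mul_nonneg (hδ i).le (sq_nonneg _)) (ha i) (had i)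
  have hAz : ∀ u : Fin n → ℝ, p * (u ⬝ᵥ A *ᵥ z) = ∑ i, δ i * x i * u i := by
    intro u
    simp only [dotProduct, Finset.mul_sum]
    refine Finset.sum_congr rfl fun i _ => ?_
    rw [heq]; ring
  have hsym : z ⬝ᵥ A *ᵥ w = w ⬝ᵥ A *ᵥ z := by
    rw [dotProduct_mulVec, ← mulVec_transpose, hA.eq, dotProduct_comm]
  obtain ⟨k, hk⟩ : ∃ k, x k ≠ 0 := by
    by_contra hcon
    push Not at hcon
    exact hx (funext hcon)
  by_cases hu : (e ⬝ᵥ w) • z - (e ⬝ᵥ z) • w = 0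
  · by_cases hα : e ⬝ᵥ z = 0
    · have hzk : z k ≠ 0 := by rw [hz]; exact mul_ne_zero (hdp k).ne' hk
      have hβ : e ⬝ᵥ w = 0 := by
        have := congrFun hu k
        simp [hα] at this
        tauto
      exact (he w hw hβ).trans_le ((m1 w).trans (m2 w))
    · set c := (e ⬝ᵥ w) / (e ⬝ᵥ z) with hc
      have hwc : w = c • z := by
        ext i
        have := congrFun hu i
        simp at this
        simp [hc]
        field_simp
        linarith
      have hc0 : c ≠ 0 := by
        intro h0
        rw [h0, zero_smul] at hwc
        exact hw hwc
      have e1 : p * (w ⬝ᵥ A *ᵥ w) = ∑ i, δ i * w i ^ 2 / d i := by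
        have : w ⬝ᵥ A *ᵥ w = c * (w ⬝ᵥ A *ᵥ z) := by
          conv_lhs => rw [hwc, mulVec_smul, dotProduct_smul, ← hwc]
          rfl
        rw [this, mul_left_comm, hAz, Finset.mul_sum]
        refine Finset.sum_congr rfl fun i _ => ?_
        have h1 := (hdp i).ne'
        rw [hwc]
        simp only [Pi.smul_apply, smul_eq_mul, hz]
        field_simp
      rw [e1]
      refine Finset.sum_lt_sum (fun i _ => ?_) ⟨k, Finset.mem_univ _, ?_⟩
      · exact div_le_div_of_nonneg_left (mul_nonneg (hδ i).le (sq_nonneg _)) (ha i) (had i)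
      · refine div_lt_div_of_pos_left (mul_pos (hδ k) ?_) (ha k) (had' k hk)
        have : w k ≠ 0 := by
          rw [hwc]
          simp only [Pi.smul_apply, smul_eq_mul, hz]
          exact mul_ne_zero hc0 (mul_ne_zero (hdp k).ne' hk)
        positivity
  · have h1 := (he _ hu (by simp [dotProduct_sub, dotProduct_smul]; ring)).trans_le (m1 _)
    generalize e ⬝ᵥ w = β at *
    generalize e ⬝ᵥ z = α at *
    have e1 : p * ((β • z - α • w) ⬝ᵥ A *ᵥ (β • z - α • w)) =
        β ^ 2 * (∑ i, δ i * x i * z i) - 2 * α * β * (∑ i, δ i * x i * w i)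
          + α ^ 2 * (p * (w ⬝ᵥ A *ᵥ w)) := by
      rw [← hAz, ← hAz]
      simp only [mulVec_sub, mulVec_smul, dotProduct_sub, sub_dotProduct, dotProduct_smul,
        smul_dotProduct, smul_eq_mul, hsym]
      ring
    have e2 : ∑ i, δ i * (β • z - α • w) i ^ 2 / d i =
        β ^ 2 * (∑ i, δ i * x i * z i) - 2 * α * β * (∑ i, δ i * x i * w i)
          + α ^ 2 * ∑ i, δ i * w i ^ 2 / d i := by
      simp only [Finset.mul_sum, ← Finset.sum_add_distrib, ← Finset.sum_sub_distrib]
      refine Finset.sum_congr rfl fun i _ => ?_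
      have h1 := (hdp i).ne'
      simp only [Pi.smul_apply, Pi.sub_apply, smul_eq_mul, hz]
      field_simp
      ring
    rw [e1, e2] at h1
    have h2 : α ^ 2 * (p * (w ⬝ᵥ A *ᵥ w)) < α ^ 2 * ∑ i, δ i * w i ^ 2 / d i := by linarith
    exact (lt_of_mul_lt_mul_left h2 (sq_nonneg _)).trans_le (m2 w)

lemma aux_spec {n : ℕ} (M : Matrix (Fin n) (Fin n) ℝ) (hM : M.IsHermitian) (k : Fin n) (p : ℝ)
    (hk : ∀ i, i ≠ k → p * hM.eigenvalues i < 1) (v : Fin n → ℝ) (hv : v ≠ 0)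
    (ho : (hM.eigenvectorBasis k).ofLp ⬝ᵥ v = 0) : p * (v ⬝ᵥ M *ᵥ v) < v ⬝ᵥ v := by
  have key : ∀ u v : Fin n → ℝ, ∑ i, (u ⬝ᵥ (hM.eigenvectorBasis i).ofLp) *
      ((hM.eigenvectorBasis i).ofLp ⬝ᵥ v) = u ⬝ᵥ v := by
    intro u v
    have := hM.eigenvectorBasis.sum_inner_mul_inner (WithLp.toLp 2 u) (WithLp.toLp 2 v)
    simp only [EuclideanSpace.inner_eq_star_dotProduct, star_trivial] at this
    rw [dotProduct_comm u v, ← this]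
    refine Finset.sum_congr rfl fun i _ => ?_
    rw [dotProduct_comm u, dotProduct_comm _ v]
  have hMv : ∀ i, (hM.eigenvectorBasis i).ofLp ⬝ᵥ M *ᵥ v =
      hM.eigenvalues i * ((hM.eigenvectorBasis i).ofLp ⬝ᵥ v) := by
    intro i
    have hT : Mᵀ = M := by rw [← conjTranspose_eq_transpose_of_trivial]; exact hM
    rw [dotProduct_mulVec, ← mulVec_transpose, hT, hM.mulVec_eigenvectorBasis]
    simp
  rw [← key v (M *ᵥ v), ← key v v, Finset.mul_sum]
  have hle : ∀ i, p * ((v ⬝ᵥ (hM.eigenvectorBasis i).ofLp) *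
      ((hM.eigenvectorBasis i).ofLp ⬝ᵥ M *ᵥ v)) =
      (p * hM.eigenvalues i) * ((hM.eigenvectorBasis i).ofLp ⬝ᵥ v) ^ 2 := by
    intro i
    rw [hMv, dotProduct_comm v]; ring
  obtain ⟨j, hj⟩ : ∃ j, (hM.eigenvectorBasis j).ofLp ⬝ᵥ v ≠ 0 := by
    by_contra hcon
    push Not at hcon
    have := key v v
    simp only [hcon, mul_zero, Finset.sum_const_zero] at this
    exact hv (dotProduct_self_eq_zero.1 this.symm)
  have hjk : j ≠ k := by
    rintro rfl
    exact hj ho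
  refine Finset.sum_lt_sum (fun i _ => ?_) ⟨j, Finset.mem_univ _, ?_⟩
  · rw [hle, dotProduct_comm v]
    by_cases hik : i = k
    · subst hik; rw [ho]; simp
    · nlinarith [hk i hik, sq_nonneg ((hM.eigenvectorBasis i).ofLp ⬝ᵥ v)]
  · rw [hle, dotProduct_comm v]
    have : 0 < ((hM.eigenvectorBasis j).ofLp ⬝ᵥ v) ^ 2 := by positivity
    nlinarith [hk j hjk]

lemma aux_quad_s3 {n : ℕ} (A : Matrix (Fin n) (Fin n) ℝ) (s v : Fin n → ℝ) :
    v ⬝ᵥ (Matrix.diagonal s * A * Matrix.diagonal s) *ᵥ v =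
      (fun i => s i * v i) ⬝ᵥ A *ᵥ (fun i => s i * v i) := by
  have h : Matrix.diagonal s *ᵥ v = fun i => s i * v i := by
    ext i; simp [mulVec_diagonal]
  rw [← mulVec_mulVec, h, ← mulVec_mulVec]
  simp [dotProduct, mulVec_diagonal]
  refine Finset.sum_congr rfl fun i _ => ?_
  ring

lemma aux_hom {n : ℕ} (q : (Fin n → ℝ) → ℝ) (hq : Continuous q)
    (hh : ∀ (c : ℝ) y, q (c • y) = c ^ 2 * q y) (hpos : ∀ y, y ≠ 0 → 0 < q y) :
    ∃ m : ℝ, 0 < m ∧ ∀ y, m * ‖y‖ ^ 2 ≤ q y := by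
  obtain ⟨m, hm, hm'⟩ := (isCompact_sphere (0 : Fin n → ℝ) 1).exists_forall_le'
    hq.continuousOn (a := 0) (fun y hy => hpos y (by
      rintro rfl
      simp at hy))
  refine ⟨m, hm, fun y => ?_⟩
  by_cases hy : y = 0
  · subst hy
    have := hh 0 0
    simp at this
    simp [this]
  · have hn : ‖y‖ ≠ 0 := norm_ne_zero_iff.2 hy
    have h1 := hm' (‖y‖⁻¹ • y) (by simp [norm_smul, hn])
    rw [hh] at h1
    have h2 : 0 < ‖y‖ ^ 2 := by positivity
    have h3 : q y = (‖y‖⁻¹ ^ 2 * q y) * ‖y‖ ^ 2 := by field_simp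
    rw [h3]
    exact mul_le_mul_of_nonneg_right h1 h2.le

lemma aux_stab {n : ℕ} (g : (Fin n → ℝ) → (Fin n → ℝ)) (xs : Fin n → ℝ)
    (J : (Fin n → ℝ) →L[ℝ] (Fin n → ℝ)) (hJ : HasFDerivAt g J xs) (hg : g xs = 0)
    (a : Fin n → ℝ) (ha : ∀ i, 0 < a i)
    (hneg : ∀ y : Fin n → ℝ, y ≠ 0 → ∑ i, a i * y i * (J y) i < 0) :
    ∃ r : ℝ, 0 < r ∧ ∀ f : ℝ → Fin n → ℝ, (∀ t : ℝ, HasDerivAt f (g (f t)) t) →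
      ‖f 0 - xs‖ < r → Tendsto f atTop (nhds xs) := by
  obtain ⟨m, hm, hmV⟩ := aux_hom (n := n) (fun y => ∑ i, a i * y i ^ 2) (by fun_prop)
    (fun c y => by
      simp only [Finset.mul_sum, Pi.smul_apply, smul_eq_mul]
      refine Finset.sum_congr rfl fun i _ => by ring)
    (fun y hy => by
      obtain ⟨k, hk⟩ : ∃ k, y k ≠ 0 := by
        by_contra hcon
        push Not at hcon
        exact hy (funext hcon)
      refine Finset.sum_pos' (fun i _ => mul_nonneg (ha i).le (sq_nonneg _))
        ⟨k, Finset.mem_univ _, mul_pos (ha k) (by positivity)⟩)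
  obtain ⟨c, hc, hcV⟩ := aux_hom (n := n) (fun y => - ∑ i, a i * y i * (J y) i) (by fun_prop)
    (fun c y => by
      simp only [mul_neg, Finset.mul_sum, Pi.smul_apply, smul_eq_mul, map_smul]
      congr 1
      refine Finset.sum_congr rfl fun i _ => by ring)
    (fun y hy => by linarith [hneg y hy])
  set K : ℝ := ∑ i, a i + 1 with hKdef
  have hK0 : 0 ≤ ∑ i, a i := Finset.sum_nonneg fun i _ => (ha i).le
  have hK : 0 < K := by linarith
  have hVK : ∀ y : Fin n → ℝ, ∑ i, a i * y i ^ 2 ≤ K * ‖y‖ ^ 2 := by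
    intro y
    calc ∑ i, a i * y i ^ 2 ≤ ∑ i, a i * ‖y‖ ^ 2 := by
          refine Finset.sum_le_sum fun i _ => mul_le_mul_of_nonneg_left ?_ (ha i).le
          have := norm_le_pi_norm y i
          rw [Real.norm_eq_abs] at this
          exact sq_le_sq' (by linarith [neg_abs_le (y i)]) (le_of_abs_le this)
      _ = (∑ i, a i) * ‖y‖ ^ 2 := by rw [Finset.sum_mul]
      _ ≤ K * ‖y‖ ^ 2 := mul_le_mul_of_nonneg_right (by linarith) (by positivity)
  have hη : 0 < c / (2 * K) := by positivity
  have hlo := hJ.isLittleO.def hη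
  obtain ⟨ε, hε, hball⟩ := Metric.eventually_nhds_iff.1 hlo
  have hdec : ∀ x, ‖x - xs‖ < ε → ∑ i, a i * (2 * (x i - xs i) * g x i) ≤
      -(c / K) * ∑ i, a i * (x i - xs i) ^ 2 := by
    intro x hx
    have h1 := hball (y := x) (by rwa [dist_eq_norm])
    rw [hg, sub_zero] at h1
    have h2 := hcV (x - xs)
    have h3 := hVK (x - xs)
    simp only [Pi.sub_apply] at h2 h3
    set R := g x - J (x - xs) with hR
    have h4 : ∑ i, a i * (x i - xs i) * R i ≤ c / 2 * ‖x - xs‖ ^ 2 := by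
      calc ∑ i, a i * (x i - xs i) * R i
          ≤ ∑ i, a i * (‖x - xs‖ * (c / (2 * K) * ‖x - xs‖)) := by
            refine Finset.sum_le_sum fun i _ => ?_
            rw [mul_assoc]
            refine mul_le_mul_of_nonneg_left ?_ (ha i).le
            refine (le_abs_self _).trans ?_
            rw [abs_mul]
            exact mul_le_mul (norm_le_pi_norm (x - xs) i) ((norm_le_pi_norm R i).trans h1)
              (abs_nonneg _) (norm_nonneg _)
        _ = (∑ i, a i) * (c / (2 * K) * ‖x - xs‖ ^ 2) := by
            rw [← Finset.sum_mul]; ring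
        _ ≤ K * (c / (2 * K) * ‖x - xs‖ ^ 2) :=
            mul_le_mul_of_nonneg_right (by linarith) (by positivity)
        _ = c / 2 * ‖x - xs‖ ^ 2 := by field_simp
    have h5 : ∑ i, a i * (2 * (x i - xs i) * g x i) =
        2 * (∑ i, a i * (x i - xs i) * (J (x - xs)) i) + 2 * ∑ i, a i * (x i - xs i) * R i := by
      simp only [Finset.mul_sum, ← Finset.sum_add_distrib]
      refine Finset.sum_congr rfl fun i _ => ?_
      simp only [hR, Pi.sub_apply]
      ring
    have h6 : (c / K) * ∑ i, a i * (x i - xs i) ^ 2 ≤ c * ‖x - xs‖ ^ 2 := by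
      calc _ ≤ (c / K) * (K * ‖x - xs‖ ^ 2) := mul_le_mul_of_nonneg_left h3 (by positivity)
        _ = _ := by field_simp
    rw [h5]
    linarith
  set B0 : ℝ := m * ε ^ 2 / 2 with hB0
  have hB0p : 0 < B0 := by positivity
  refine ⟨Real.sqrt (B0 / K), by positivity, fun f hf h0 => ?_⟩
  set V : ℝ → ℝ := fun t => ∑ i, a i * (f t i - xs i) ^ 2 with hV
  set c' : ℝ := c / K / 2 with hc'
  have hc'p : 0 < c' := by positivity
  have hVd : ∀ t, HasDerivAt V (∑ i, a i * (2 * (f t i - xs i) * g (f t) i)) t := by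
    intro t
    refine HasDerivAt.fun_sum fun i _ => ?_
    have h1 := (((hasDerivAt_pi.1 (hf t) i).sub_const (xs i)).pow 2).const_mul (a i)
    convert! h1 using 1
    simp
  have hV0 : V 0 ≤ B0 := by
    have h1 := hVK (f 0 - xs)
    have h2 : ‖f 0 - xs‖ ^ 2 ≤ B0 / K := by
      rw [← Real.sq_sqrt (show 0 ≤ B0 / K by positivity)]
      exact pow_le_pow_left₀ (norm_nonneg _) h0.le 2
    calc V 0 ≤ K * ‖f 0 - xs‖ ^ 2 := h1
      _ ≤ K * (B0 / K) := mul_le_mul_of_nonneg_left h2 hK.le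
      _ = B0 := by field_simp
  have hBd : ∀ t, HasDerivAt (fun t => B0 * Real.exp (-c' * t))
      (B0 * (Real.exp (-c' * t) * (-c' * 1))) t := fun t =>
    (((hasDerivAt_id t).const_mul (-c')).exp).const_mul B0
  have hmain : ∀ T, 0 ≤ T → V T ≤ B0 * Real.exp (-c' * T) := by
    intro T hT
    refine image_le_of_deriv_right_lt_deriv_boundary (f := V) (a := 0) (b := T)
      (fun t _ => (hVd t).continuousAt.continuousWithinAt)
      (fun t _ => (hVd t).hasDerivWithinAt) (by simpa using hV0) hBd ?_ ⟨hT, le_rfl⟩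
    intro t ht hVt
    have hB : 0 < B0 * Real.exp (-c' * t) := by positivity
    have hle : B0 * Real.exp (-c' * t) ≤ B0 := by
      refine mul_le_of_le_one_right hB0p.le (Real.exp_le_one_iff.2 ?_)
      nlinarith [ht.1]
    have hnear : ‖f t - xs‖ < ε := by
      have h1 : m * ‖f t - xs‖ ^ 2 ≤ V t := hmV (f t - xs)
      have h2 : m * ‖f t - xs‖ ^ 2 < m * ε ^ 2 := by
        have : 0 < m * ε ^ 2 := by positivity
        linarith
      exact lt_of_pow_lt_pow_left₀ 2 hε.le (lt_of_mul_lt_mul_left h2 hm.le)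
    have h3 := hdec _ hnear
    change _ ≤ -(c / K) * V t at h3
    refine h3.trans_lt ?_
    rw [hVt]
    have : c / K = 2 * c' := by rw [hc']; ring
    rw [this]
    nlinarith [mul_pos hB hc'p]
  rw [tendsto_iff_norm_sub_tendsto_zero]
  have hlim : Tendsto (fun t => Real.sqrt (B0 / m * Real.exp (-c' * t))) atTop (nhds 0) := by
    have h1 : Tendsto (fun t : ℝ => Real.exp (-c' * t)) atTop (nhds 0) :=
      Real.tendsto_exp_atBot.comp (tendsto_id.const_mul_atTop_of_neg (by linarith))
    have h2 := (h1.const_mul (B0 / m)).sqrt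
    simpa using h2
  refine squeeze_zero' (Eventually.of_forall fun t => norm_nonneg _) ?_ hlim
  filter_upwards [eventually_ge_atTop 0] with t ht
  refine Real.le_sqrt_of_sq_le ?_
  have h1 : m * ‖f t - xs‖ ^ 2 ≤ V t := hmV (f t - xs)
  have h2 := h1.trans (hmain t ht)
  rw [div_mul_eq_mul_div, le_div_iff₀ hm]
  linarith

/-- for `π ∈ (π_1, π_2)` (i.e. `π·λ_{n−1}(M) < 1 < π·λ_n(M)`) with
`λ_n(M)` simple, every nontrivial equilibrium `x*` of `ẋ = −Δx + πAψ(x)` satisfies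
`π·λ_max(Ψ^{1/2} M Ψ^{1/2}) < 1` with `Ψ = diag(ψ_i′(x*_i))`; consequently every
eigenvalue of the Jacobian `Δ(−I + πΔ⁻¹AΨ)` is negative and `x*` is locally
asymptotically stable. -/
theorem stmt_3 {n : ℕ} (hn : 2 ≤ n)
    (A : Matrix (Fin n) (Fin n) ℝ) (hA : A.IsSymm)
    (hdiag : ∀ i, A i i = 0) (hrow : ∀ i, ∃ j, A i j ≠ 0)
    (δ : Fin n → ℝ) (hδ : ∀ i, δ i = ∑ j, |A i j|)
    (M : Matrix (Fin n) (Fin n) ℝ)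
    (hM : M = Matrix.diagonal (fun i => (Real.sqrt (δ i))⁻¹) * A *
      Matrix.diagonal (fun i => (Real.sqrt (δ i))⁻¹))
    (ψ : Fin n → ℝ → ℝ) (hψ : ∀ i, IsSigmoid (ψ i))
    (p : ℝ) (hp : 0 < p)
    (hsimple : lambdaSorted M ⟨n - 2, by omega⟩ < lambdaSorted M ⟨n - 1, by omega⟩)
    (hlow : p * lambdaSorted M ⟨n - 2, by omega⟩ < 1)
    (hhigh : 1 < p * lambdaSorted M ⟨n - 1, by omega⟩)
    (xs : Fin n → ℝ) (hxs : xs ≠ 0)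
    (heq : (Matrix.diagonal δ).mulVec xs = p • A.mulVec (fun i => ψ i (xs i))) :
    p * lambdaMax (Matrix.diagonal (fun i => Real.sqrt (deriv (ψ i) (xs i))) * M *
        Matrix.diagonal (fun i => Real.sqrt (deriv (ψ i) (xs i)))) < 1 ∧
    (∀ μ : ℝ, (∃ v : Fin n → ℝ, v ≠ 0 ∧
        (Matrix.diagonal δ * (-(1 : Matrix (Fin n) (Fin n) ℝ) +
          p • ((Matrix.diagonal δ)⁻¹ * A *
            Matrix.diagonal (fun i => deriv (ψ i) (xs i))))).mulVec v = μ • v) →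
      μ < 0) ∧
    ∃ r : ℝ, 0 < r ∧ ∀ f : ℝ → Fin n → ℝ,
      (∀ t : ℝ, HasDerivAt f
        (-((Matrix.diagonal δ).mulVec (f t)) + p • A.mulVec (fun i => ψ i (f t i))) t) →
      ‖f 0 - xs‖ < r → Tendsto f atTop (nhds xs) := by
  have hδp : ∀ i, 0 < δ i := by
    intro i
    rw [hδ]
    obtain ⟨j, hj⟩ := hrow i
    exact Finset.sum_pos' (fun _ _ => abs_nonneg _) ⟨j, Finset.mem_univ _, abs_pos.2 hj⟩
  have hAt : Aᴴ = A := by rw [conjTranspose_eq_transpose_of_trivial]; exact hA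
  have hMH : M.IsHermitian := by
    rw [hM, IsHermitian]
    simp [hA.eq, Matrix.mul_assoc]
  obtain ⟨e, he⟩ : ∃ e : Fin n → ℝ, ∀ u : Fin n → ℝ, u ≠ 0 → e ⬝ᵥ u = 0 →
      p * (u ⬝ᵥ A *ᵥ u) < ∑ i, δ i * u i ^ 2 := by
    set σ := Tuple.sort hMH.eigenvalues with hσ
    have hlow' : p * hMH.eigenvalues (σ ⟨n - 2, by omega⟩) < 1 := by
      rw [lambdaSorted, dif_pos hMH] at hlow
      exact hlow
    have hmono : Monotone (hMH.eigenvalues ∘ σ) := Tuple.monotone_sort _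
    set k := σ ⟨n - 1, by omega⟩ with hk
    refine ⟨fun i => Real.sqrt (δ i) * (hMH.eigenvectorBasis k).ofLp i, fun u hu hu0 => ?_⟩
    have h1 := aux_spec M hMH k p ?_ (fun i => Real.sqrt (δ i) * u i) ?_ ?_
    · have h2 : (fun i => (Real.sqrt (δ i))⁻¹ * (Real.sqrt (δ i) * u i)) = u := by
        ext i
        have := (Real.sqrt_pos.2 (hδp i)).ne'
        field_simp
      have h3 := aux_quad_s3 A (fun i => (Real.sqrt (δ i))⁻¹) (fun i => Real.sqrt (δ i) * u i)
      rw [← hM, h2] at h3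
      rw [h3] at h1
      refine h1.trans_eq ?_
      simp only [dotProduct]
      refine Finset.sum_congr rfl fun i _ => ?_
      have := Real.mul_self_sqrt (hδp i).le
      calc _ = (Real.sqrt (δ i) * Real.sqrt (δ i)) * u i ^ 2 := by ring
        _ = _ := by rw [this]
    · intro i hik
      have h4 : σ.symm i ≤ ⟨n - 2, by omega⟩ := by
        have : σ.symm i ≠ ⟨n - 1, by omega⟩ := by
          intro hh
          apply hik
          rw [hk, ← hh, Equiv.apply_symm_apply]
        have h5 : (σ.symm i).val ≠ n - 1 := fun hh => this (Fin.ext hh)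
        rw [Fin.le_def]
        simp only
        have := (σ.symm i).isLt
        omega
      have h6 := hmono h4
      simp only [Function.comp_apply, Equiv.apply_symm_apply] at h6
      exact (mul_le_mul_of_nonneg_left h6 hp.le).trans_lt hlow'
    · intro hh
      apply hu
      ext i
      have := congrFun hh i
      simp only [Pi.zero_apply, mul_eq_zero] at this
      exact this.resolve_left (Real.sqrt_pos.2 (hδp i)).ne'
    · rw [← hu0]
      simp only [dotProduct]
      refine Finset.sum_congr rfl fun i _ => by ring
  choose d hd1 hd2 hd3 hd4 using fun i => aux_sig (hψ i) (xs i)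
  set a : Fin n → ℝ := fun i => deriv (ψ i) (xs i) with hadef
  have ha : ∀ i, 0 < a i := fun i => (hψ i).deriv_pos _
  have hF : ∀ w : Fin n → ℝ, w ≠ 0 → p * (w ⬝ᵥ A *ᵥ w) < ∑ i, δ i * w i ^ 2 / a i := by
    intro w hw
    refine aux_core A hA p δ e xs a d (fun i => ψ i (xs i)) hδp he ha hd1 hd2 hd3 hxs hd4 ?_ w hw
    intro i
    have := congrFun heq i
    simpa [mulVec_diagonal] using this
  have hFa : ∀ v : Fin n → ℝ, v ≠ 0 →
      ∑ i, a i * v i * (-(δ i * v i) + p * (A *ᵥ fun j => a j * v j) i) < 0 := by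
    intro v hv
    have h1 := hF (fun i => a i * v i) (by
      intro hh
      apply hv
      ext i
      have := congrFun hh i
      simp only [Pi.zero_apply, mul_eq_zero] at this
      exact this.resolve_left (ha i).ne')
    have h2 : ∑ i, a i * v i * (-(δ i * v i) + p * (A *ᵥ fun j => a j * v j) i) =
        p * ((fun i => a i * v i) ⬝ᵥ A *ᵥ (fun i => a i * v i)) -
          ∑ i, δ i * (a i * v i) ^ 2 / a i := by
      simp only [dotProduct, Finset.mul_sum, ← Finset.sum_sub_distrib]
      refine Finset.sum_congr rfl fun i _ => ?_
      have := (ha i).ne'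
      field_simp
      ring
    rw [h2]
    linarith
  refine ⟨?_, ?_, ?_⟩
  · set N := Matrix.diagonal (fun i => Real.sqrt (deriv (ψ i) (xs i))) * M *
        Matrix.diagonal (fun i => Real.sqrt (deriv (ψ i) (xs i))) with hN
    have hNH : N.IsHermitian := by
      rw [hN, IsHermitian]
      have hMt : Mᵀ = M := by rw [← conjTranspose_eq_transpose_of_trivial]; exact hMH
      simp [hMt, Matrix.mul_assoc]
    have hev : ∀ i, p * hNH.eigenvalues i < 1 := by
      intro i
      set v := (hNH.eigenvectorBasis i).ofLp with hv
      have hv0 : v ≠ 0 := by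
        intro hh
        apply hNH.eigenvectorBasis.toBasis.ne_zero i
        rw [OrthonormalBasis.coe_toBasis]
        ext j
        exact congrFun hh j
      have h1 : N *ᵥ v = hNH.eigenvalues i • v := hNH.mulVec_eigenvectorBasis i
      have h2 : v ⬝ᵥ N *ᵥ v = hNH.eigenvalues i * (v ⬝ᵥ v) := by
        rw [h1, dotProduct_smul]; rfl
      have h2' : v ⬝ᵥ N *ᵥ v = _ := aux_quad_s3 M _ v
      rw [h2', hM, aux_quad_s3] at h2
      have h3 := hF (fun j => (Real.sqrt (δ j))⁻¹ * (Real.sqrt (deriv (ψ j) (xs j)) * v j)) (by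
        intro hh
        apply hv0
        ext j
        have := congrFun hh j
        simp only [Pi.zero_apply, mul_eq_zero, inv_eq_zero] at this
        have k1 := (Real.sqrt_pos.2 (hδp j)).ne'
        have k2 := (Real.sqrt_pos.2 (ha j)).ne'
        exact (this.resolve_left k1).resolve_left k2)
      rw [h2] at h3
      have h4 : ∑ j, δ j * ((Real.sqrt (δ j))⁻¹ * (Real.sqrt (deriv (ψ j) (xs j)) * v j)) ^ 2 / a j
          = v ⬝ᵥ v := by
        simp only [dotProduct]
        refine Finset.sum_congr rfl fun j _ => ?_
        rw [mul_pow, mul_pow, inv_pow, Real.sq_sqrt (hδp j).le, Real.sq_sqrt (ha j).le]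
        have k1 := (hδp j).ne'
        have k2 := (ha j).ne'
        change δ j * ((δ j)⁻¹ * (a j * v j ^ 2)) / a j = _
        field_simp
      rw [h4] at h3
      have h5 : 0 < v ⬝ᵥ v := by
        have h6 : 0 ≤ v ⬝ᵥ v := Finset.sum_nonneg fun j _ => mul_self_nonneg _
        exact lt_of_le_of_ne h6 (fun hh => hv0 (dotProduct_self_eq_zero.1 hh.symm))
      nlinarith
    have : Nonempty (Fin n) := ⟨⟨0, by omega⟩⟩
    obtain ⟨i, hi⟩ := exists_eq_ciSup_of_finite (f := lambdaSorted N)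
    rw [lambdaMax, ← hi]
    rw [lambdaSorted, dif_pos hNH]
    exact hev _
  · rintro μ ⟨v, hv, hJv⟩
    have hD : Matrix.diagonal δ * (Matrix.diagonal δ)⁻¹ = 1 := by
      apply Matrix.mul_nonsing_inv
      rw [det_diagonal, isUnit_iff_ne_zero]
      exact Finset.prod_ne_zero_iff.2 fun i _ => (hδp i).ne'
    have h1 : Matrix.diagonal δ * (-(1 : Matrix (Fin n) (Fin n) ℝ) +
          p • ((Matrix.diagonal δ)⁻¹ * A * Matrix.diagonal a)) =
        - Matrix.diagonal δ + p • (A * Matrix.diagonal a) := by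
      rw [mul_add, mul_neg, mul_one, mul_smul_comm, ← mul_assoc, ← mul_assoc, hD, one_mul]
    rw [h1] at hJv
    have h2 : ∀ i, -(δ i * v i) + p * (A *ᵥ fun j => a j * v j) i = μ * v i := by
      intro i
      have h3 := congrFun hJv i
      have h4 : Matrix.diagonal a *ᵥ v = fun j => a j * v j := by
        ext j; simp [mulVec_diagonal]
      simpa [add_mulVec, neg_mulVec, smul_mulVec, ← mulVec_mulVec, h4, mulVec_diagonal] using h3
    have h3 := hFa v hv
    simp only [h2] at h3
    have h4 : ∑ i, a i * v i * (μ * v i) = μ * ∑ i, a i * v i ^ 2 := by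
      rw [Finset.mul_sum]
      refine Finset.sum_congr rfl fun i _ => by ring
    rw [h4] at h3
    have h5 : 0 ≤ ∑ i, a i * v i ^ 2 :=
      Finset.sum_nonneg fun i _ => mul_nonneg (ha i).le (sq_nonneg _)
    by_contra hcon
    push Not at hcon
    exact absurd h3 (not_lt.2 (mul_nonneg hcon h5))
  · have hψd : ∀ i, HasDerivAt (ψ i) (a i) (xs i) := fun i =>
      (((hψ i).contDiff.differentiable (by norm_num)) (xs i)).hasDerivAt
    let Jl : (Fin n → ℝ) →L[ℝ] (Fin n → ℝ) := LinearMap.toContinuousLinearMap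
      (Matrix.toLin' (- Matrix.diagonal δ + p • (A * Matrix.diagonal a)))
    refine aux_stab (fun x => -((Matrix.diagonal δ).mulVec x) + p • A.mulVec (fun i => ψ i (x i)))
      xs Jl ?_ ?_ a ha ?_
    · have hin : HasFDerivAt (fun x : Fin n → ℝ => fun i => ψ i (x i))
          (LinearMap.toContinuousLinearMap (Matrix.toLin' (Matrix.diagonal a))) xs := by
        rw [hasFDerivAt_pi']
        intro i
        have h1 := (hψd i).comp_hasFDerivAt xs
          (ContinuousLinearMap.proj (R := ℝ) (φ := fun _ : Fin n => ℝ) i).hasFDerivAt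
        convert! h1 using 1
        ext v
        simp [mulVec_diagonal]
      have hA1 := (LinearMap.toContinuousLinearMap (Matrix.toLin' A)).hasFDerivAt.comp xs hin
      have hD1 := (LinearMap.toContinuousLinearMap (Matrix.toLin' (Matrix.diagonal δ))).hasFDerivAt
        (x := xs)
      have h3 := hD1.neg.add (hA1.const_smul p)
      convert! h3 using 1
      ext v i
      simp [Jl, mulVec_diagonal]
    · simp only [heq]
      simp
    · intro y hy
      have h4 : Matrix.diagonal a *ᵥ y = fun j => a j * y j := by
        ext j; simp [mulVec_diagonal]
      have h5 := hFa y hy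
      simpa [Jl, add_mulVec, neg_mulVec, smul_mulVec, ← mulVec_mulVec, h4, mulVec_diagonal] using h5
end

section
/- Let A ∈ ℝ^{n×n} be symmetric, irreducible, with zero diagonal, representing a structurally unbalanced connected signed graph; let δ_i := Σ_j |A_{ij}|, Δ := diag(δ_1,…,δ_n), M := Δ^{-1/2} A Δ^{-1/2}, and let ψ_1,…,ψ_n satisfy (A.1)–(A.4). Assume λ_n(M) is simple and π > 0 satisfies π·λ_{n−1}(M) < 1 < π·λ_n(M). Then the set of solutions of Δx = πAψ(x) consists of exactly three points: the origin and a pair ±x* with x* ≠ 0. -/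
open Matrix Filter Set

lemma s2 {n : ℕ} (N : Matrix (Fin n) (Fin n) ℝ) (hN : N.IsSymm) (w a : Fin n → ℝ)
    (hpos : ∀ z, z ≠ 0 → w ⬝ᵥ z = 0 → 0 < z ⬝ᵥ N *ᵥ z) (ha : a ≠ 0) (hNa : N *ᵥ a = 0) (b : Fin n → ℝ) :
    0 ≤ b ⬝ᵥ N *ᵥ b ∧ (b ⬝ᵥ N *ᵥ b = 0 → ∃ c : ℝ, b = c • a) := by
  have hwa : w ⬝ᵥ a ≠ 0 := by
    intro h
    have := hpos a ha h
    rw [hNa] at this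
    simp at this
  set c := (w ⬝ᵥ b) / (w ⬝ᵥ a) with hc
  have hk : w ⬝ᵥ (b - c • a) = 0 := by
    rw [dotProduct_sub, dotProduct_smul, hc, smul_eq_mul]; field_simp; simp
  have haN : ∀ y, a ⬝ᵥ N *ᵥ y = 0 := by
    intro y
    rw [dotProduct_mulVec, ← mulVec_transpose, hN.eq, hNa, zero_dotProduct]
  have hq : (b - c • a) ⬝ᵥ N *ᵥ (b - c • a) = b ⬝ᵥ N *ᵥ b := by
    rw [mulVec_sub, mulVec_smul, hNa, sub_dotProduct, smul_dotProduct, smul_zero, sub_zero, haN]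
    simp
  by_cases hz : b - c • a = 0
  · refine ⟨?_, fun _ => ⟨c, sub_eq_zero.mp hz⟩⟩
    rw [← hq, hz]; simp
  · have := hpos _ hz hk
    rw [hq] at this
    exact ⟨this.le, fun h => absurd h this.ne'⟩

lemma spec {n : ℕ} (M : Matrix (Fin n) (Fin n) ℝ) (hM : M.IsHermitian) (p : ℝ) (i0 : Fin n)
    (h0 : 1 < p * hM.eigenvalues i0) (h1 : ∀ i, i ≠ i0 → p * hM.eigenvalues i < 1) :
    ∃ v : Fin n → ℝ, v ⬝ᵥ v < p * (v ⬝ᵥ M *ᵥ v) ∧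
      ∀ z, z ≠ 0 → v ⬝ᵥ z = 0 → p * (z ⬝ᵥ M *ᵥ z) < z ⬝ᵥ z := by
  let V := hM.eigenvectorBasis
  have hMV : ∀ i, M *ᵥ (V i).ofLp = hM.eigenvalues i • (V i).ofLp := fun i => hM.mulVec_eigenvectorBasis i
  have hin : ∀ x y : EuclideanSpace ℝ (Fin n), inner ℝ x y = x.ofLp ⬝ᵥ y.ofLp := by
    intro x y
    rw [EuclideanSpace.inner_eq_star_dotProduct, dotProduct_comm]; simp
  have hon : ∀ i, (V i).ofLp ⬝ᵥ (V i).ofLp = 1 := by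
    intro i
    rw [← hin, real_inner_self_eq_norm_sq, V.orthonormal.1 i]; norm_num
  refine ⟨(V i0).ofLp, ?_, ?_⟩
  · rw [hMV, dotProduct_smul, hon]; simpa using h0
  · intro z hz hv
    have e1 : z ⬝ᵥ z = ∑ i, ((V i).ofLp ⬝ᵥ z) * ((V i).ofLp ⬝ᵥ z) := by
      have := V.sum_inner_mul_inner (WithLp.toLp 2 z) (WithLp.toLp 2 z)
      simp only [hin] at this
      rw [← this]
      exact Finset.sum_congr rfl fun i _ => by rw [dotProduct_comm z]
    have e2 : z ⬝ᵥ M *ᵥ z = ∑ i, hM.eigenvalues i * (((V i).ofLp ⬝ᵥ z) * ((V i).ofLp ⬝ᵥ z)) := by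
      have := V.sum_inner_mul_inner (WithLp.toLp 2 z) (WithLp.toLp 2 (M *ᵥ z))
      simp only [hin] at this
      rw [← this]
      refine Finset.sum_congr rfl fun i _ => ?_
      have : (V i).ofLp ⬝ᵥ M *ᵥ z = hM.eigenvalues i * ((V i).ofLp ⬝ᵥ z) := by
        have hs : Mᵀ = M := by simpa using hM.eq
        rw [dotProduct_mulVec, ← mulVec_transpose, hs, hMV, smul_dotProduct, smul_eq_mul]
      rw [this, dotProduct_comm z]; ring
    have hzz : 0 < z ⬝ᵥ z := by
      have : z ⬝ᵥ z ≠ 0 := fun h => hz (dotProduct_self_eq_zero.mp h)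
      have h2 : 0 ≤ z ⬝ᵥ z := Finset.sum_nonneg fun i _ => mul_self_nonneg _
      exact lt_of_le_of_ne h2 this.symm
    have hex : ∃ i, (V i).ofLp ⬝ᵥ z ≠ 0 := by
      by_contra! h
      rw [e1] at hzz
      simp [h] at hzz
    rw [e2, e1, Finset.mul_sum]
    apply Finset.sum_lt_sum
    · intro i _
      by_cases hi : i = i0
      · rw [hi, hv]; simp
      · nlinarith [h1 i hi, mul_self_nonneg ((V i).ofLp ⬝ᵥ z)]
    · obtain ⟨i, hi⟩ := hex
      have hii : i ≠ i0 := fun h => hi (h ▸ hv)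
      refine ⟨i, Finset.mem_univ _, ?_⟩
      have := mul_self_pos.mpr hi
      nlinarith [h1 i hii]

namespace IsSigmoid
variable {f : ℝ → ℝ}

lemma diff (h : IsSigmoid f) : Differentiable ℝ f := h.contDiff.differentiable (by norm_num)

lemma zero (h : IsSigmoid f) : f 0 = 0 := by
  have := h.odd 0
  rw [neg_zero] at this; linarith

lemma smono (h : IsSigmoid f) : StrictMono f := strictMono_of_deriv_pos h.deriv_pos

lemma sconc (h : IsSigmoid f) : StrictConcaveOn ℝ (Ici (0:ℝ)) f := by
  refine StrictAntiOn.strictConcaveOn_of_deriv (convex_Ici 0) h.diff.continuous.continuousOn ?_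
  rw [interior_Ici]
  exact h.strictConcaveOn.strictAntiOn_deriv fun x _ => h.diff x

lemma deriv_le (h : IsSigmoid f) (x : ℝ) : deriv f x ≤ 1 := by
  have key : ∀ x, 0 ≤ x → deriv f x ≤ 1 := by
    intro x hx
    rw [← h.deriv_zero]
    exact (h.sconc.strictAntiOn_deriv fun x _ => h.diff x).antitoneOn (by simp) hx hx
  rcases le_total 0 x with hx | hx
  · exact key x hx
  · have h1 : deriv f (-x) = deriv f x := by
      have e : (fun y => f (-y)) = fun y => - f y := funext h.odd
      have := deriv_comp_neg f x
      rw [e, deriv.fun_neg] at this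
      linarith
    rw [← h1]; exact key _ (by linarith)

lemma lt_one (h : IsSigmoid f) (x : ℝ) : f x ≤ 1 := h.smono.monotone.ge_of_tendsto h.tendsto_atTop x

lemma abs_le (h : IsSigmoid f) (x : ℝ) : |f x| ≤ 1 := by
  rw [_root_.abs_le]
  refine ⟨?_, h.lt_one x⟩
  have := h.lt_one (-x)
  rw [h.odd] at this; linarith

lemma pos (h : IsSigmoid f) {x : ℝ} (hx : 0 < x) : 0 < f x := by
  have := h.smono hx
  rwa [h.zero] at this

lemma slope (h : IsSigmoid f) {x y : ℝ} (hx : 0 < x) (hxy : x < y) : f y * x < f x * y := by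
  have := h.sconc.slope_anti_adjacent (x := 0) (y := x) (z := y) (by simp) (by simp; linarith) hx hxy
  rw [h.zero, div_lt_div_iff₀ (by linarith) (by linarith)] at this
  nlinarith

lemma le_self (h : IsSigmoid f) {x : ℝ} (hx : 0 ≤ x) : f x ≤ x := by
  have : MonotoneOn (fun y => y - f y) (Ici (0:ℝ)) := by
    apply monotoneOn_of_deriv_nonneg (convex_Ici 0)
    · exact (continuous_id.sub h.diff.continuous).continuousOn
    · exact (differentiable_id.sub h.diff).differentiableOn
    · intro y _
      have : HasDerivAt (fun y => y - f y) (1 - deriv f y) y := (hasDerivAt_id y).sub (h.diff y).hasDerivAt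
      rw [this.deriv]; linarith [h.deriv_le y]
  have := this (by simp : (0:ℝ) ∈ Ici (0:ℝ)) hx hx
  simp [h.zero] at this
  exact this

end IsSigmoid

/-- gain -/
noncomputable def gain (f : ℝ → ℝ) (x : ℝ) : ℝ := if x = 0 then 1 else x / f x

lemma IsSigmoid.ne {f : ℝ → ℝ} (h : IsSigmoid f) {x : ℝ} (hx : x ≠ 0) : f x ≠ 0 := by
  intro h0
  rw [← h.zero] at h0
  exact hx (h.smono.injective h0)

lemma gain_mul {f : ℝ → ℝ} (h : IsSigmoid f) (x : ℝ) : gain f x * f x = x := by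
  unfold gain
  split_ifs with hx
  · rw [hx, h.zero]; simp
  · exact div_mul_cancel₀ _ (h.ne hx)

lemma gain_neg {f : ℝ → ℝ} (h : IsSigmoid f) (x : ℝ) : gain f (-x) = gain f x := by
  unfold gain
  simp [h.odd, neg_div_neg_eq]

lemma gain_abs {f : ℝ → ℝ} (h : IsSigmoid f) (x : ℝ) : gain f |x| = gain f x := by
  rcases abs_choice x with e | e <;> rw [e]
  exact gain_neg h x

lemma sq_abs' {f : ℝ → ℝ} (h : IsSigmoid f) (x : ℝ) : f |x| ^ 2 = f x ^ 2 := by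
  rcases abs_choice x with e | e <;> rw [e]
  rw [h.odd]; ring

lemma one_le_gain {f : ℝ → ℝ} (h : IsSigmoid f) (x : ℝ) : 1 ≤ gain f x := by
  rw [← gain_abs h]
  unfold gain
  split_ifs with hx
  · exact le_rfl
  · have : 0 < |x| := lt_of_le_of_ne (abs_nonneg x) (Ne.symm hx)
    rw [le_div_iff₀ (h.pos this), one_mul]
    exact h.le_self this.le

lemma gain_lt {f : ℝ → ℝ} (h : IsSigmoid f) {x y : ℝ} (hx : 0 ≤ x) (hxy : x < y) :
    gain f x < gain f y := by
  have hy : 0 < y := by linarith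
  rcases hx.eq_or_lt with rfl | hx
  · have h2 : 0 < y / 2 := by linarith
    have := h.slope h2 (by linarith : y / 2 < y)
    have h3 := h.le_self h2.le
    unfold gain
    rw [if_pos rfl, if_neg hy.ne', lt_div_iff₀ (h.pos hy)]
    nlinarith
  · unfold gain
    rw [if_neg hx.ne', if_neg hy.ne', div_lt_div_iff₀ (h.pos hx) (h.pos hy)]
    linarith [h.slope hx hxy]

lemma gain_key {f : ℝ → ℝ} (h : IsSigmoid f) (x y : ℝ) :
    (gain f x - gain f y) * (f y ^ 2 - f x ^ 2) ≤ 0 ∧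
    ((gain f x - gain f y) * (f y ^ 2 - f x ^ 2) = 0 → |x| = |y|) := by
  have key : ∀ u v : ℝ, 0 ≤ u → u < v → (gain f u - gain f v) * (f v ^ 2 - f u ^ 2) < 0 := by
    intro u v hu huv
    have h1 := gain_lt h hu huv
    have h2 := h.smono huv
    have h3 : 0 ≤ f u := by
      have := h.smono.monotone hu
      rwa [h.zero] at this
    apply mul_neg_of_neg_of_pos
    · linarith
    · nlinarith
  rw [← gain_abs h x, ← gain_abs h y, ← sq_abs' h x, ← sq_abs' h y]
  rcases lt_trichotomy |x| |y| with hh | hh | hh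
  · have := key _ _ (abs_nonneg x) hh
    exact ⟨this.le, fun h => absurd h this.ne⟩
  · exact ⟨by rw [hh]; simp, fun _ => hh⟩
  · have := key _ _ (abs_nonneg y) hh
    have e : (gain f |x| - gain f |y|) * (f |y| ^ 2 - f |x| ^ 2) = (gain f |y| - gain f |x|) * (f |x| ^ 2 - f |y| ^ 2) := by ring
    rw [e]
    exact ⟨this.le, fun h => absurd h this.ne⟩

/-- potential -/
noncomputable def pot (f : ℝ → ℝ) (x : ℝ) : ℝ := x * f x - ∫ s in (0:ℝ)..x, f s

lemma pot_deriv {f : ℝ → ℝ} (h : IsSigmoid f) (x : ℝ) : HasDerivAt (pot f) (x * deriv f x) x := by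
  have h1 : HasDerivAt (fun x => ∫ s in (0:ℝ)..x, f s) (f x) x :=
    h.diff.continuous.integral_hasStrictDerivAt 0 x |>.hasDerivAt
  have h2 := ((hasDerivAt_id x).mul (h.diff x).hasDerivAt).sub h1
  exact h2.congr_deriv (by simp)

lemma pot_zero {f : ℝ → ℝ} : pot f 0 = 0 := by simp [pot]

lemma pot_le {f : ℝ → ℝ} (h : IsSigmoid f) (x : ℝ) : pot f x ≤ x ^ 2 / 2 := by
  have hd : ∀ x, HasDerivAt (fun x => x ^ 2 / 2 - pot f x) (x * (1 - deriv f x)) x := by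
    intro x
    have := ((hasDerivAt_pow 2 x).div_const 2).sub (pot_deriv h x)
    exact this.congr_deriv (by simp; ring)
  have hc : Differentiable ℝ (fun x => x ^ 2 / 2 - pot f x) := fun x => (hd x).differentiableAt
  rcases le_total 0 x with hx | hx
  · have : MonotoneOn (fun x => x ^ 2 / 2 - pot f x) (Ici (0:ℝ)) := by
      apply monotoneOn_of_deriv_nonneg (convex_Ici 0) hc.continuous.continuousOn hc.differentiableOn
      intro y hy
      rw [interior_Ici] at hy
      rw [(hd y).deriv]
      exact mul_nonneg (le_of_lt hy) (by linarith [h.deriv_le y])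
    have := this (by simp : (0:ℝ) ∈ Ici (0:ℝ)) hx hx
    simp [pot_zero] at this
    linarith
  · have : AntitoneOn (fun x => x ^ 2 / 2 - pot f x) (Iic (0:ℝ)) := by
      apply antitoneOn_of_deriv_nonpos (convex_Iic 0) hc.continuous.continuousOn hc.differentiableOn
      intro y hy
      rw [interior_Iic] at hy
      rw [(hd y).deriv]
      exact mul_nonpos_of_nonpos_of_nonneg (le_of_lt hy) (by linarith [h.deriv_le y])
    have := this hx (by simp : (0:ℝ) ∈ Iic (0:ℝ)) hx
    simp [pot_zero] at this
    linarith

lemma exist_sol {n : ℕ} (A : Matrix (Fin n) (Fin n) ℝ) (hA : A.IsSymm)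
    (δ : Fin n → ℝ) (hδ : ∀ i, δ i = ∑ j, |A i j|) (hδ0 : ∀ i, 0 < δ i)
    (ψ : Fin n → ℝ → ℝ) (hψ : ∀ i, IsSigmoid (ψ i)) (p : ℝ) (hp : 0 < p)
    (e : Fin n → ℝ) (he : ∑ i, δ i * e i ^ 2 < p * ∑ i, ∑ j, A i j * (e i * e j)) :
    ∃ x : Fin n → ℝ, x ≠ 0 ∧ ∀ i, δ i * x i = p * ∑ j, A i j * ψ j (x j) := by
  set V : (Fin n → ℝ) → ℝ := fun x => ∑ i, δ i * pot (ψ i) (x i) -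
    p / 2 * ∑ i, ∑ j, A i j * (ψ i (x i) * ψ j (x j)) with hV
  have hpc : ∀ i, Continuous (pot (ψ i)) := fun i =>
    (show Differentiable ℝ (pot (ψ i)) from fun x => (pot_deriv (hψ i) x).differentiableAt).continuous
  have hψc : ∀ i, Continuous (ψ i) := fun i => (hψ i).diff.continuous
  have hVc : Continuous V := by
    have h1 : ∀ i, Continuous fun x : Fin n → ℝ => pot (ψ i) (x i) := fun i => (hpc i).comp (continuous_apply i)
    have h2 : ∀ i, Continuous fun x : Fin n → ℝ => ψ i (x i) := fun i => (hψc i).comp (continuous_apply i)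
    rw [hV]
    fun_prop
  have hK : IsCompact (Icc (fun _ : Fin n => -p) (fun _ => p)) := isCompact_Icc
  have h0K : (0 : Fin n → ℝ) ∈ Icc (fun _ : Fin n => -p) (fun _ => p) :=
    ⟨fun i => by simp [hp.le], fun i => by simp [hp.le]⟩
  obtain ⟨x, hxK, hxmin⟩ := hK.exists_isMinOn ⟨0, h0K⟩ hVc.continuousOn
  refine ⟨x, ?_, ?_⟩
  · -- V takes a negative value
    rintro rfl
    have hV0 : V 0 = 0 := by
      simp [hV, pot_zero, (hψ _).zero]
    have hquot : ∀ i, Tendsto (fun t : ℝ => t⁻¹ * ψ i (t * e i)) (nhdsWithin 0 (Ioi 0)) (nhds (e i)) := by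
      intro i
      have h1 : HasDerivAt (fun t : ℝ => ψ i (t * e i)) (e i) 0 := by
        have h2 : HasDerivAt (ψ i) 1 ((0:ℝ) * e i) := by
          rw [zero_mul, ← (hψ i).deriv_zero]; exact ((hψ i).diff 0).hasDerivAt
        have h3 : HasDerivAt (fun t : ℝ => t * e i) (1 * e i) 0 := (hasDerivAt_id (0:ℝ)).mul_const (e i)
        exact (h2.comp (0:ℝ) h3).congr_deriv (by simp)
      have := h1.tendsto_slope_zero_right
      simpa [(hψ i).zero] using this
    have hlim : Tendsto (fun t : ℝ => ∑ i, δ i * (e i ^ 2 / 2) -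
        p / 2 * ∑ i, ∑ j, A i j * ((t⁻¹ * ψ i (t * e i)) * (t⁻¹ * ψ j (t * e j)))) (nhdsWithin 0 (Ioi 0))
        (nhds (∑ i, δ i * (e i ^ 2 / 2) - p / 2 * ∑ i, ∑ j, A i j * (e i * e j))) := by
      refine tendsto_const_nhds.sub (Tendsto.const_mul _ ?_)
      refine tendsto_finsetSum _ fun i _ => tendsto_finsetSum _ fun j _ => ?_
      exact ((hquot i).mul (hquot j)).const_mul _
    have hneg : ∑ i, δ i * (e i ^ 2 / 2) - p / 2 * ∑ i, ∑ j, A i j * (e i * e j) < 0 := by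
      have : ∑ i, δ i * (e i ^ 2 / 2) = (∑ i, δ i * e i ^ 2) / 2 := by
        rw [Finset.sum_div]; exact Finset.sum_congr rfl fun i _ => by ring
      rw [this]; linarith
    have hev := hlim.eventually (gt_mem_nhds hneg)
    have hev2 : ∀ᶠ t : ℝ in nhdsWithin 0 (Ioi 0), ∀ i, t * e i ∈ Ioo (-p) p := by
      rw [eventually_all]
      intro i
      have : Tendsto (fun t : ℝ => t * e i) (nhds 0) (nhds 0) := by
        have : Continuous fun t : ℝ => t * e i := by fun_prop
        simpa using this.tendsto 0
      exact (this.mono_left nhdsWithin_le_nhds).eventually (Ioo_mem_nhds (by linarith) hp)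
    obtain ⟨t, ⟨ht1, ht2⟩, ht3⟩ := (hev.and hev2 |>.and self_mem_nhdsWithin).exists
    have ht : 0 < t := ht3
    have hmem : (fun i => t * e i) ∈ Icc (fun _ : Fin n => -p) (fun _ => p) :=
      ⟨fun i => (ht2 i).1.le, fun i => (ht2 i).2.le⟩
    have h1 : V 0 ≤ V (fun i => t * e i) := hxmin hmem
    have h2 : V (fun i => t * e i) ≤ t ^ 2 * (∑ i, δ i * (e i ^ 2 / 2) -
        p / 2 * ∑ i, ∑ j, A i j * ((t⁻¹ * ψ i (t * e i)) * (t⁻¹ * ψ j (t * e j)))) := by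
      rw [mul_sub, hV]
      have e1 : t ^ 2 * (p / 2 * ∑ i, ∑ j, A i j * ((t⁻¹ * ψ i (t * e i)) * (t⁻¹ * ψ j (t * e j)))) =
          p / 2 * ∑ i, ∑ j, A i j * (ψ i (t * e i) * ψ j (t * e j)) := by
        rw [mul_left_comm, Finset.mul_sum]
        congr 1
        refine Finset.sum_congr rfl fun i _ => ?_
        rw [Finset.mul_sum]
        refine Finset.sum_congr rfl fun j _ => ?_
        field_simp
      rw [e1]
      apply sub_le_sub_right
      rw [Finset.mul_sum]
      apply Finset.sum_le_sum
      intro i _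
      have := pot_le (hψ i) (t * e i)
      have := mul_le_mul_of_nonneg_left this (hδ0 i).le
      calc _ ≤ _ := this
        _ = _ := by ring
    have h3 := mul_neg_of_pos_of_neg (pow_pos ht 2) ht1
    linarith
  · -- first order condition
    set y : Fin n → ℝ := fun i => p * (∑ j, A i j * ψ j (x j)) / δ i with hy
    have hyb : ∀ i, |y i| ≤ p := by
      intro i
      rw [hy]
      simp only
      rw [abs_div, abs_of_pos (hδ0 i), div_le_iff₀ (hδ0 i), abs_mul, abs_of_pos hp]
      apply mul_le_mul_of_nonneg_left _ hp.le
      rw [hδ i]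
      refine (Finset.abs_sum_le_sum_abs _ _).trans (Finset.sum_le_sum fun j _ => ?_)
      rw [abs_mul]
      exact mul_le_of_le_one_right (abs_nonneg _) ((hψ j).abs_le _)
    have hyδ : ∀ i, p * (∑ j, A i j * ψ j (x j)) = δ i * y i := by
      intro i
      rw [hy]; simp only
      rw [mul_div_cancel₀ _ (hδ0 i).ne']
    have hyK : y ∈ Icc (fun _ : Fin n => -p) (fun _ => p) :=
      ⟨fun i => (_root_.abs_le.mp (hyb i)).1, fun i => (_root_.abs_le.mp (hyb i)).2⟩
    have hline : ∀ i, HasDerivAt (fun t : ℝ => x i + t * (y i - x i)) (y i - x i) 0 := by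
      intro i
      exact (((hasDerivAt_id (0:ℝ)).mul_const (y i - x i)).const_add (x i)).congr_deriv (by simp)
    have hdψ : ∀ i, HasDerivAt (fun t : ℝ => ψ i (x i + t * (y i - x i)))
        (deriv (ψ i) (x i) * (y i - x i)) 0 := by
      intro i
      have h2 : HasDerivAt (ψ i) (deriv (ψ i) (x i)) (x i + 0 * (y i - x i)) := by
        rw [zero_mul, add_zero]; exact ((hψ i).diff _).hasDerivAt
      exact h2.comp (0:ℝ) (hline i)
    have hdp : ∀ i, HasDerivAt (fun t : ℝ => pot (ψ i) (x i + t * (y i - x i)))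
        (x i * deriv (ψ i) (x i) * (y i - x i)) 0 := by
      intro i
      have h2 : HasDerivAt (pot (ψ i)) (x i * deriv (ψ i) (x i)) (x i + 0 * (y i - x i)) := by
        rw [zero_mul, add_zero]; exact pot_deriv (hψ i) _
      exact h2.comp (0:ℝ) (hline i)
    have hdV : HasDerivAt (fun t : ℝ => V (fun i => x i + t * (y i - x i)))
        (∑ i, δ i * (x i * deriv (ψ i) (x i) * (y i - x i)) - p / 2 * ∑ i, ∑ j, A i j *
          (deriv (ψ i) (x i) * (y i - x i) * ψ j (x j) + ψ i (x i) * (deriv (ψ j) (x j) * (y j - x j)))) 0 := by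
      rw [hV]
      refine HasDerivAt.fun_sub (HasDerivAt.fun_sum fun i _ => (hdp i).const_mul _)
        (HasDerivAt.const_mul _ (HasDerivAt.fun_sum fun i _ => HasDerivAt.fun_sum fun j _ => ?_))
      exact (((hdψ i).fun_mul (hdψ j)).const_mul (A i j)).congr_deriv (by simp)
    have hsym : ∑ i, ∑ j, A i j * (ψ i (x i) * (deriv (ψ j) (x j) * (y j - x j))) =
        ∑ i, ∑ j, A i j * (deriv (ψ i) (x i) * (y i - x i) * ψ j (x j)) := by
      rw [Finset.sum_comm]
      refine Finset.sum_congr rfl fun i _ => Finset.sum_congr rfl fun j _ => ?_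
      rw [hA.apply i j]; ring
    have hval : (∑ i, δ i * (x i * deriv (ψ i) (x i) * (y i - x i)) - p / 2 * ∑ i, ∑ j, A i j *
          (deriv (ψ i) (x i) * (y i - x i) * ψ j (x j) + ψ i (x i) * (deriv (ψ j) (x j) * (y j - x j)))) =
        - ∑ i, δ i * deriv (ψ i) (x i) * (y i - x i) ^ 2 := by
      simp only [mul_add, Finset.sum_add_distrib]
      rw [hsym]
      have : ∀ i, p * ∑ j, A i j * (deriv (ψ i) (x i) * (y i - x i) * ψ j (x j)) =
          δ i * y i * (deriv (ψ i) (x i) * (y i - x i)) := by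
        intro i
        rw [← hyδ i, mul_assoc, Finset.sum_mul]
        congr 1
        exact Finset.sum_congr rfl fun j _ => by ring
      have h2 : p * ∑ i, ∑ j, A i j * (deriv (ψ i) (x i) * (y i - x i) * ψ j (x j)) =
          ∑ i, δ i * y i * (deriv (ψ i) (x i) * (y i - x i)) := by
        rw [Finset.mul_sum]; exact Finset.sum_congr rfl fun i _ => this i
      have h3 : ∀ S : ℝ, p / 2 * S + p / 2 * S = p * S := fun S => by ring
      rw [h3, h2, ← Finset.sum_sub_distrib, ← Finset.sum_neg_distrib]
      exact Finset.sum_congr rfl fun i _ => by ring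
    rw [hval] at hdV
    have hge : 0 ≤ - ∑ i, δ i * deriv (ψ i) (x i) * (y i - x i) ^ 2 := by
      refine ge_of_tendsto hdV.tendsto_slope_zero_right ?_
      filter_upwards [Ioo_mem_nhdsGT (zero_lt_one' ℝ)] with t ht
      have hmem : (fun i => x i + t * (y i - x i)) ∈ Icc (fun _ : Fin n => -p) (fun _ => p) := by
        have := (convex_Icc (fun _ : Fin n => -p) (fun _ => p)).add_smul_sub_mem hxK hyK ⟨ht.1.le, ht.2.le⟩
        exact this
      have h1 : V x ≤ V (fun i => x i + t * (y i - x i)) := hxmin hmem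
      rw [smul_eq_mul]
      apply mul_nonneg (inv_nonneg.mpr ht.1.le)
      simp only [zero_add, zero_mul, add_zero]
      linarith
    have hnn : ∀ i ∈ Finset.univ, 0 ≤ δ i * deriv (ψ i) (x i) * (y i - x i) ^ 2 := fun i _ =>
      mul_nonneg (mul_pos (hδ0 i) ((hψ i).deriv_pos _)).le (sq_nonneg _)
    have hz := (Finset.sum_eq_zero_iff_of_nonneg hnn).mp (le_antisymm (by linarith) (Finset.sum_nonneg hnn))
    intro i
    rw [hyδ i]
    have := hz i (Finset.mem_univ i)
    have hne := (mul_pos (hδ0 i) ((hψ i).deriv_pos (x i))).ne'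
    have h2 := (mul_eq_zero.mp this).resolve_left hne
    have h3 : y i - x i = 0 := by simpa using h2
    have h4 : y i = x i := by linarith
    rw [h4]

lemma uniq_sol {n : ℕ} (A : Matrix (Fin n) (Fin n) ℝ) (hA : A.IsSymm)
    (δ : Fin n → ℝ) (hδ0 : ∀ i, 0 < δ i)
    (ψ : Fin n → ℝ → ℝ) (hψ : ∀ i, IsSigmoid (ψ i)) (p : ℝ)
    (w : Fin n → ℝ) (hw : ∀ z, z ≠ 0 → w ⬝ᵥ z = 0 → p * (z ⬝ᵥ A *ᵥ z) < ∑ i, δ i * z i ^ 2)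
    (x y : Fin n → ℝ) (hx0 : x ≠ 0) (hy0 : y ≠ 0)
    (hx : ∀ i, δ i * x i = p * ∑ j, A i j * ψ j (x j))
    (hy : ∀ i, δ i * y i = p * ∑ j, A i j * ψ j (y j)) : y = x ∨ y = -x := by
  let N : (Fin n → ℝ) → Matrix (Fin n) (Fin n) ℝ := fun x =>
    Matrix.diagonal (fun i => δ i * gain (ψ i) (x i)) - p • A
  have hN : ∀ x, (N x).IsSymm := fun x => (isSymm_diagonal _).sub (hA.smul p)
  have hNq : ∀ x z, z ⬝ᵥ N x *ᵥ z = ∑ i, δ i * gain (ψ i) (x i) * z i ^ 2 - p * (z ⬝ᵥ A *ᵥ z) := by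
    intro x z
    simp only [N]
    rw [sub_mulVec, dotProduct_sub, smul_mulVec, dotProduct_smul, smul_eq_mul]
    congr 1
    simp only [dotProduct, mulVec_diagonal]
    exact Finset.sum_congr rfl fun i _ => by ring
  have hpos : ∀ x z, z ≠ 0 → w ⬝ᵥ z = 0 → 0 < z ⬝ᵥ N x *ᵥ z := by
    intro x z hz hwz
    rw [hNq]
    have h1 := hw z hz hwz
    have h2 : ∑ i, δ i * z i ^ 2 ≤ ∑ i, δ i * gain (ψ i) (x i) * z i ^ 2 := by
      refine Finset.sum_le_sum fun i _ => ?_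
      have := one_le_gain (hψ i) (x i)
      have h3 := mul_nonneg (hδ0 i).le (sq_nonneg (z i))
      nlinarith
    linarith
  let a : (Fin n → ℝ) → (Fin n → ℝ) := fun x i => ψ i (x i)
  have ha0 : ∀ x : Fin n → ℝ, x ≠ 0 → a x ≠ 0 := by
    intro x hx h
    apply hx
    funext i
    by_contra hi
    exact (hψ i).ne hi (congrFun h i)
  have hNa : ∀ x : Fin n → ℝ, (∀ i, δ i * x i = p * ∑ j, A i j * ψ j (x j)) → N x *ᵥ a x = 0 := by
    intro x hx
    funext i
    simp only [N]
    rw [sub_mulVec, smul_mulVec, Pi.sub_apply, mulVec_diagonal, Pi.smul_apply, smul_eq_mul]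
    have : (A *ᵥ a x) i = ∑ j, A i j * ψ j (x j) := rfl
    rw [this, ← hx i, mul_assoc, gain_mul (hψ i)]; simp
  have qx := s2 (N x) (hN x) w (a x) (hpos x) (ha0 x hx0) (hNa x hx) (a y)
  have qy := s2 (N y) (hN y) w (a y) (hpos y) (ha0 y hy0) (hNa y hy) (a x)
  have zx : a x ⬝ᵥ N x *ᵥ a x = 0 := by rw [hNa x hx]; simp
  have zy : a y ⬝ᵥ N y *ᵥ a y = 0 := by rw [hNa y hy]; simp
  rw [hNq] at qx qy zx zy
  have hsum : ∑ i, δ i * ((gain (ψ i) (x i) - gain (ψ i) (y i)) * (ψ i (y i) ^ 2 - ψ i (x i) ^ 2)) =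
      (∑ i, δ i * gain (ψ i) (x i) * a y i ^ 2 - ∑ i, δ i * gain (ψ i) (x i) * a x i ^ 2) +
      (∑ i, δ i * gain (ψ i) (y i) * a x i ^ 2 - ∑ i, δ i * gain (ψ i) (y i) * a y i ^ 2) := by
    rw [← Finset.sum_sub_distrib, ← Finset.sum_sub_distrib, ← Finset.sum_add_distrib]
    exact Finset.sum_congr rfl fun i _ => by simp only [a]; ring
  have hnp : ∀ i ∈ Finset.univ, δ i * ((gain (ψ i) (x i) - gain (ψ i) (y i)) * (ψ i (y i) ^ 2 - ψ i (x i) ^ 2)) ≤ 0 :=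
    fun i _ => mul_nonpos_of_nonneg_of_nonpos (hδ0 i).le (gain_key (hψ i) _ _).1
  have hz := (Finset.sum_eq_zero_iff_of_nonpos hnp).mp
    (le_antisymm (Finset.sum_nonpos hnp) (by rw [hsum]; linarith [qx.1, qy.1]))
  have habs : ∀ i, |x i| = |y i| := fun i => (gain_key (hψ i) _ _).2
    ((mul_eq_zero.mp (hz i (Finset.mem_univ i))).resolve_left (hδ0 i).ne')
  have hg : ∀ i, gain (ψ i) (x i) = gain (ψ i) (y i) := by
    intro i
    rw [← gain_abs (hψ i), habs, gain_abs (hψ i)]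
  obtain ⟨c, hc⟩ := qx.2 (by simp only [hg]; exact zy)
  have hci : ∀ i, ψ i (y i) = c * ψ i (x i) := fun i => congrFun hc i
  have hc1 : c = 1 ∨ c = -1 := by
    obtain ⟨i, hi⟩ := Function.ne_iff.mp (ha0 x hx0)
    have hi : ψ i (x i) ≠ 0 := hi
    have h1 : ψ i (y i) ^ 2 = ψ i (x i) ^ 2 := by
      rw [← sq_abs' (hψ i), ← habs, sq_abs' (hψ i)]
    rw [hci, mul_pow] at h1
    have h2 : c ^ 2 = 1 := by
      have := pow_ne_zero 2 hi
      exact mul_right_cancel₀ this (by rw [h1, one_mul])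
    have h4 : (c - 1) * (c + 1) = 0 := by ring_nf; linarith
    rcases mul_eq_zero.mp h4 with h5 | h5
    · left; linarith
    · right; linarith
  rcases hc1 with rfl | rfl
  · left; funext i
    exact (hψ i).smono.injective (by rw [hci]; simp)
  · right; funext i
    exact (hψ i).smono.injective (by rw [hci, Pi.neg_apply, (hψ i).odd]; simp)

/-- for a structurally unbalanced connected signed graph, when
`λ_n(M)` is simple and `π·λ_{n−1}(M) < 1 < π·λ_n(M)`, the equilibrium equation
`Δx = πAψ(x)` has exactly three solutions: `0` and a pair `±x*` with `x* ≠ 0`. -/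
theorem stmt_4 {n : ℕ} (hn : 2 ≤ n)
    (A : Matrix (Fin n) (Fin n) ℝ) (hA : A.IsSymm)
    (hdiag : ∀ i, A i i = 0)
    (hirr : ¬ ∃ P : Fin n → Prop, (∃ i, P i) ∧ (∃ i, ¬ P i) ∧
      ∀ i j, P i → ¬ P j → A i j = 0)
    (hunb : ¬ ∃ s : Fin n → ℝ, (∀ i, s i = 1 ∨ s i = -1) ∧
      ∀ i j, 0 ≤ s i * A i j * s j)
    (δ : Fin n → ℝ) (hδ : ∀ i, δ i = ∑ j, |A i j|)
    (M : Matrix (Fin n) (Fin n) ℝ)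
    (hM : M = Matrix.diagonal (fun i => (Real.sqrt (δ i))⁻¹) * A *
      Matrix.diagonal (fun i => (Real.sqrt (δ i))⁻¹))
    (ψ : Fin n → ℝ → ℝ) (hψ : ∀ i, IsSigmoid (ψ i))
    (p : ℝ) (hp : 0 < p)
    (hsimple : lambdaSorted M ⟨n - 2, by omega⟩ < lambdaSorted M ⟨n - 1, by omega⟩)
    (hlow : p * lambdaSorted M ⟨n - 2, by omega⟩ < 1)
    (hhigh : 1 < p * lambdaSorted M ⟨n - 1, by omega⟩) :
    ∃ xs : Fin n → ℝ, xs ≠ 0 ∧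
      ∀ x : Fin n → ℝ,
        (Matrix.diagonal δ).mulVec x = p • A.mulVec (fun i => ψ i (x i)) ↔
          (x = 0 ∨ x = xs ∨ x = -xs) := by
  have hδ0 : ∀ i, 0 < δ i := by
    intro i
    have hnn : 0 ≤ δ i := by rw [hδ]; exact Finset.sum_nonneg fun _ _ => abs_nonneg _
    refine lt_of_le_of_ne hnn fun h => hirr ⟨fun k => k = i, ⟨i, rfl⟩, ?_, ?_⟩
    · have : Nontrivial (Fin n) := Fin.nontrivial_iff_two_le.mpr hn
      exact exists_ne i
    · rintro k j rfl _
      rw [hδ] at h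
      have := (Finset.sum_eq_zero_iff_of_nonneg fun _ _ => abs_nonneg _).mp h.symm j (Finset.mem_univ j)
      exact abs_eq_zero.mp this
  have hMH : M.IsHermitian := by
    have : Mᵀ = M := by
      rw [hM, transpose_mul, transpose_mul, diagonal_transpose, hA.eq, Matrix.mul_assoc]
    rw [Matrix.IsHermitian, conjTranspose_eq_transpose_of_trivial, this]
  have hls : ∀ k, lambdaSorted M k = hMH.eigenvalues (Tuple.sort hMH.eigenvalues k) := by
    intro k
    unfold lambdaSorted
    rw [dif_pos hMH]
    rfl
  have hmono := Tuple.monotone_sort hMH.eigenvalues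
  rw [hls] at hlow hhigh
  obtain ⟨v, hv1, hv2⟩ := spec M hMH p _ hhigh (by
    intro i hi
    obtain ⟨k, rfl⟩ := (Tuple.sort hMH.eigenvalues).surjective i
    have hk : k ≠ ⟨n - 1, by omega⟩ := fun h => hi (by rw [h])
    have hk2 : k ≤ ⟨n - 2, by omega⟩ := by
      have h1 : k.val ≠ n - 1 := fun h => hk (Fin.ext h)
      have h2 := k.isLt
      rw [Fin.le_def]
      simp only
      omega
    have h3 : hMH.eigenvalues (Tuple.sort hMH.eigenvalues k) ≤ _ := hmono hk2
    exact lt_of_le_of_lt (mul_le_mul_of_nonneg_left h3 hp.le) hlow)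
  have hs0 : ∀ i, 0 < Real.sqrt (δ i) := fun i => Real.sqrt_pos.mpr (hδ0 i)
  have hss : ∀ i, Real.sqrt (δ i) * Real.sqrt (δ i) = δ i := fun i => Real.mul_self_sqrt (hδ0 i).le
  have hMij : ∀ i j, M i j = (Real.sqrt (δ i))⁻¹ * A i j * (Real.sqrt (δ j))⁻¹ := by
    intro i j
    rw [hM, mul_diagonal, diagonal_mul]
  -- transfer of the quadratic forms
  have tr : ∀ b : Fin n → ℝ, (fun i => Real.sqrt (δ i) * b i) ⬝ᵥ M *ᵥ (fun i => Real.sqrt (δ i) * b i) =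
      b ⬝ᵥ A *ᵥ b := by
    intro b
    simp only [dotProduct, mulVec]
    refine Finset.sum_congr rfl fun i _ => ?_
    rw [mul_comm (Real.sqrt (δ i)), mul_assoc, Finset.mul_sum]
    congr 1
    refine Finset.sum_congr rfl fun j _ => ?_
    rw [hMij]
    have := (hs0 i).ne'
    have := (hs0 j).ne'
    field_simp
  have tr2 : ∀ b : Fin n → ℝ, (fun i => Real.sqrt (δ i) * b i) ⬝ᵥ (fun i => Real.sqrt (δ i) * b i) =
      ∑ i, δ i * b i ^ 2 := by
    intro b
    simp only [dotProduct]
    refine Finset.sum_congr rfl fun i _ => ?_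
    linear_combination (b i) ^ 2 * hss i
  have heq : ∀ x : Fin n → ℝ, (Matrix.diagonal δ).mulVec x = p • A.mulVec (fun i => ψ i (x i)) ↔
      ∀ i, δ i * x i = p * ∑ j, A i j * ψ j (x j) := by
    intro x
    rw [funext_iff]
    refine forall_congr' fun i => ?_
    rw [mulVec_diagonal]
    rfl
  have hw : ∀ z : Fin n → ℝ, z ≠ 0 → (fun i => v i * Real.sqrt (δ i)) ⬝ᵥ z = 0 →
      p * (z ⬝ᵥ A *ᵥ z) < ∑ i, δ i * z i ^ 2 := by
    intro z hz hwz
    rw [← tr, ← tr2]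
    apply hv2
    · intro h
      apply hz
      funext i
      have := congrFun h i
      exact (mul_eq_zero.mp this).resolve_left (hs0 i).ne'
    · rw [← hwz]
      simp only [dotProduct]
      exact Finset.sum_congr rfl fun i _ => by ring
  obtain ⟨xs, hxs0, hxs⟩ := exist_sol A hA δ hδ hδ0 ψ hψ p hp (fun i => v i / Real.sqrt (δ i)) (by
    have hvv : (fun i => Real.sqrt (δ i) * (v i / Real.sqrt (δ i))) = v := by
      funext i
      exact mul_div_cancel₀ _ (hs0 i).ne'
    have h1 := tr (fun i => v i / Real.sqrt (δ i))
    have h2 := tr2 (fun i => v i / Real.sqrt (δ i))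
    rw [hvv] at h1 h2
    rw [← h2]
    refine lt_of_lt_of_eq hv1 ?_
    rw [h1]
    simp only [dotProduct, mulVec]
    congr 1
    refine Finset.sum_congr rfl fun i _ => ?_
    rw [Finset.mul_sum]
    exact Finset.sum_congr rfl fun j _ => by ring)
  refine ⟨xs, hxs0, fun x => ?_⟩
  rw [heq]
  constructor
  · intro hx
    by_cases h0 : x = 0
    · exact Or.inl h0
    · exact Or.inr (uniq_sol A hA δ hδ0 ψ hψ p _ hw xs x hxs0 h0 hxs hx)
  · rintro (rfl | rfl | rfl)
    · intro i
      simp [(hψ _).zero]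
    · exact hxs
    · intro i
      simp only [Pi.neg_apply, (hψ _).odd, mul_neg, Finset.sum_neg_distrib, hxs i]
end

section
/- Let A ∈ ℝ^{n×n} (n ≥ 2) be symmetric, irreducible, with zero diagonal, representing a connected signed graph, let δ_i := Σ_j |A_{ij}|, Δ := diag(δ_1,…,δ_n), and M := Δ^{-1/2} A Δ^{-1/2}. If the graph is structurally unbalanced (no signature matrix S makes SAS entrywise nonnegative), then the second largest eigenvalue of M is strictly positive, λ_{n−1}(M) > 0; equivalently, the second smallest eigenvalue of the normalized signed Laplacian ℒ = I − Δ^{-1}A satisfies λ_2(ℒ) < 1. -/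
open Matrix Filter Set

theorem spec_entry {n : ℕ} (M : Matrix (Fin n) (Fin n) ℝ) (h : M.IsHermitian) (i j : Fin n) :
    M i j = ∑ k, h.eigenvalues k * (h.eigenvectorUnitary : Matrix (Fin n) (Fin n) ℝ) i k
      * (h.eigenvectorUnitary : Matrix (Fin n) (Fin n) ℝ) j k := by
  have := congrFun (congrFun h.spectral_theorem i) j
  rw [this]
  simp only [Unitary.conjStarAlgAut_apply, Matrix.mul_apply, Matrix.diagonal_apply,
    Matrix.star_apply]
  simp [mul_comm]

theorem sign_core {n : ℕ} (M : Matrix (Fin n) (Fin n) ℝ) (l : Fin n → ℝ)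
    (U : Fin n → Fin n → ℝ) (hM : ∀ i j, M i j = ∑ k, l k * U i k * U j k)
    (hd : ∀ i, M i i = 0) (k0 : Fin n) (hk : ∀ k, k ≠ k0 → l k ≤ 0) (i j : Fin n) :
    0 ≤ sgn (U i k0) * M i j * sgn (U j k0) := by
  have split : ∀ i j, M i j = l k0 * U i k0 * U j k0 -
      ∑ k ∈ Finset.univ.erase k0, (-l k) * U i k * U j k := by
    intro i j
    rw [hM, ← Finset.add_sum_erase _ _ (Finset.mem_univ k0)]
    simp [Finset.sum_neg_distrib]
  have hp : ∀ k ∈ Finset.univ.erase k0, 0 ≤ -l k := by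
    intro k hk'
    have := hk k (Finset.ne_of_mem_erase hk')
    linarith
  have cs := Finset.sum_sq_le_sum_mul_sum_of_sq_le_mul (Finset.univ.erase k0)
    (f := fun k => (-l k) * U i k * U i k) (g := fun k => (-l k) * U j k * U j k)
    (r := fun k => (-l k) * U i k * U j k)
    (fun k h => by have := hp k h; rw [mul_assoc]; exact mul_nonneg this (mul_self_nonneg _))
    (fun k h => by have := hp k h; rw [mul_assoc]; exact mul_nonneg this (mul_self_nonneg _))
    (fun k h => le_of_eq (by ring))
  have hq : ∀ i, 0 ≤ l k0 * U i k0 * U i k0 ∧ ∑ k ∈ Finset.univ.erase k0, (-l k) * U i k * U i k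
      = l k0 * U i k0 * U i k0 := by
    intro i
    have h1 := split i i
    rw [hd] at h1
    have h2 : 0 ≤ ∑ k ∈ Finset.univ.erase k0, (-l k) * U i k * U i k :=
      Finset.sum_nonneg (fun k h => by
        have := hp k h; rw [mul_assoc]; exact mul_nonneg this (mul_self_nonneg _))
    constructor <;> linarith
  rw [(hq i).2, (hq j).2] at cs
  rw [split]
  set Q := ∑ k ∈ Finset.univ.erase k0, (-l k) * U i k * U j k
  have h0 := (hq i).1
  have habs : |Q| ≤ |l k0 * U i k0 * U j k0| := by
    apply sq_le_sq.mp
    nlinarith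
  have hs : ∀ y, sgn y * y = |y| ∧ (sgn y = 1 ∨ sgn y = -1) := by
    intro y
    unfold sgn
    split_ifs with h
    · simp [abs_of_nonneg h]
    · simp [abs_of_neg (not_le.mp h)]
  have hX : sgn (U i k0) * (l k0 * U i k0 * U j k0) * sgn (U j k0) = |l k0 * U i k0 * U j k0| := by
    have e : sgn (U i k0) * (l k0 * U i k0 * U j k0) * sgn (U j k0)
        = l k0 * (sgn (U i k0) * U i k0) * (sgn (U j k0) * U j k0) := by ring
    rw [e, (hs _).1, (hs _).1, abs_mul, abs_mul]
    by_cases hz : U i k0 = 0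
    · simp [hz]
    · have : 0 ≤ l k0 := by
        have hpos : 0 < U i k0 * U i k0 := mul_self_pos.mpr hz
        rw [mul_assoc] at h0
        exact nonneg_of_mul_nonneg_left h0 hpos
      rw [abs_of_nonneg this]
  rw [mul_sub, sub_mul, hX]
  have := le_abs_self Q
  have := neg_abs_le Q
  rcases (hs (U i k0)).2 with h | h <;> rcases (hs (U j k0)).2 with h' | h' <;>
    rw [h, h'] <;> linarith

/-- Lemma 3: if the connected signed graph with adjacency matrix `A`
is structurally unbalanced, then the second largest eigenvalue of
`M = Δ^{-1/2}AΔ^{-1/2}` is strictly positive, `λ_{n−1}(M) > 0`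
(equivalently, `λ_2(ℒ) < 1`). -/
theorem stmt_5 {n : ℕ} (hn : 2 ≤ n)
    (A : Matrix (Fin n) (Fin n) ℝ) (hA : A.IsSymm)
    (hdiag : ∀ i, A i i = 0)
    (hirr : ¬ ∃ P : Fin n → Prop, (∃ i, P i) ∧ (∃ i, ¬ P i) ∧
      ∀ i j, P i → ¬ P j → A i j = 0)
    (hunb : ¬ ∃ s : Fin n → ℝ, (∀ i, s i = 1 ∨ s i = -1) ∧
      ∀ i j, 0 ≤ s i * A i j * s j)
    (δ : Fin n → ℝ) (hδ : ∀ i, δ i = ∑ j, |A i j|)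
    (M : Matrix (Fin n) (Fin n) ℝ)
    (hM : M = Matrix.diagonal (fun i => (Real.sqrt (δ i))⁻¹) * A *
      Matrix.diagonal (fun i => (Real.sqrt (δ i))⁻¹)) :
    0 < lambdaSorted M ⟨n - 2, by omega⟩ := by
  by_contra hcon
  apply hunb
  have hMe : ∀ i j, M i j = (Real.sqrt (δ i))⁻¹ * A i j * (Real.sqrt (δ j))⁻¹ := by
    intro i j
    rw [hM, Matrix.mul_diagonal, Matrix.diagonal_mul]
  have hH : M.IsHermitian := by
    ext i j
    simp only [Matrix.conjTranspose_apply, star_trivial, hMe, hA.apply i j]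
    ring
  simp only [lambdaSorted, hH, dif_pos, Function.comp, not_lt] at hcon
  have hmono := Tuple.monotone_sort hH.eigenvalues
  have core := sign_core M hH.eigenvalues _ (spec_entry M hH)
    (fun i => by rw [hMe, hdiag]; simp) (Tuple.sort hH.eigenvalues ⟨n - 1, by omega⟩) (by
      intro k hk
      obtain ⟨m, rfl⟩ := (Tuple.sort hH.eigenvalues).surjective k
      have hm : m ≤ ⟨n - 2, by omega⟩ := by
        rw [Fin.le_def]
        have : m.val ≠ n - 1 := fun h => hk (by congr 1; exact Fin.ext h)
        have := m.isLt
        simp only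
        omega
      exact (hmono hm).trans hcon)
  refine ⟨fun i => sgn ((hH.eigenvectorUnitary : Matrix (Fin n) (Fin n) ℝ) i
    (Tuple.sort hH.eigenvalues ⟨n - 1, by omega⟩)), ?_, ?_⟩
  · intro i
    simp only [sgn]
    split_ifs <;> simp
  · intro i j
    have c := core i j
    have hz : ∀ i j, δ i = 0 → A i j = 0 := by
      intro i j h
      rw [hδ, Finset.sum_eq_zero_iff_of_nonneg (fun _ _ => abs_nonneg _)] at h
      exact abs_eq_zero.mp (h j (Finset.mem_univ j))
    have hnn : ∀ i, 0 ≤ δ i := fun i => by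
      rw [hδ]; exact Finset.sum_nonneg (fun _ _ => abs_nonneg _)
    by_cases hi : δ i = 0
    · simp [hz i j hi]
    by_cases hj : δ j = 0
    · rw [← hA.apply, hz j i hj]; simp
    have pi : 0 < (Real.sqrt (δ i))⁻¹ :=
      inv_pos.mpr (Real.sqrt_pos.mpr (lt_of_le_of_ne (hnn i) (Ne.symm hi)))
    have pj : 0 < (Real.sqrt (δ j))⁻¹ :=
      inv_pos.mpr (Real.sqrt_pos.mpr (lt_of_le_of_ne (hnn j) (Ne.symm hj)))
    rw [hMe] at c
    refine nonneg_of_mul_nonneg_left (b := (Real.sqrt (δ i))⁻¹ * (Real.sqrt (δ j))⁻¹) ?_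
      (mul_pos pi pj)
    refine le_of_le_of_eq c ?_
    beta_reduce
    ring
end

section
/- Let A ∈ ℝ^{n×n} be a nonzero symmetric matrix with zero diagonal and Σ_j |A_{ij}| = δ > 0 for every i, so that H := A/δ is symmetric with zero diagonal and Σ_j |H_{ij}| = 1 for all i. Then λ_max(H) ≤ 1 and n·λ_max(H) ≥ max_{s ∈ {−1,1}^n} s^T H s. Consequently, λ_max(H) > 0 and the first bifurcation threshold π_1 := 1/λ_max(H) satisfies 1 ≤ π_1 and π_1·(n − 2ε(𝒢)) ≤ n; moreover, when λ_{n−1}(H) > 0, π_1 ≤ π_2 := 1/λ_{n−1}(H), so that 1 ≤ π_1 ≤ min{n/(n − 2ε(𝒢)), π_2} when n − 2ε(𝒢) > 0. -/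
open Matrix Filter Set

theorem aux_le_max {n : ℕ} (H : Matrix (Fin n) (Fin n) ℝ) (i : Fin n) :
    lambdaSorted H i ≤ lambdaMax H :=
  le_ciSup (Set.finite_range (lambdaSorted H)).bddAbove i

theorem aux_eig_le {n : ℕ} (H : Matrix (Fin n) (Fin n) ℝ) (hM : H.IsHermitian) (i : Fin n) :
    hM.eigenvalues i ≤ lambdaMax H := by
  have h := aux_le_max H ((Tuple.sort hM.eigenvalues).symm i)
  unfold lambdaSorted at h
  rw [dif_pos hM] at h
  simpa using h

theorem aux_rayleigh {n : ℕ} (H : Matrix (Fin n) (Fin n) ℝ) (hM : H.IsHermitian)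
    (x : Fin n → ℝ) : x ⬝ᵥ H.mulVec x ≤ lambdaMax H * (x ⬝ᵥ x) := by
  have hB : (algebraMap ℝ (Matrix (Fin n) (Fin n) ℝ) (lambdaMax H) - H).IsHermitian := by
    refine IsHermitian.sub ?_ hM
    rw [Algebra.algebraMap_eq_smul_one]
    simp [Matrix.IsHermitian]
  have hp : (algebraMap ℝ (Matrix (Fin n) (Fin n) ℝ) (lambdaMax H) - H).PosSemidef := by
    rw [hB.posSemidef_iff_eigenvalues_nonneg]
    intro i
    have h1 := hB.eigenvalues_mem_spectrum_real i
    have h2 : lambdaMax H - hB.eigenvalues i ∈ spectrum ℝ H := by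
      rw [← spectrum.singleton_sub_eq] at h1
      obtain ⟨a, ha, b, hb, hab⟩ := h1
      simp only [Set.mem_singleton_iff] at ha
      subst ha
      have : b = lambdaMax H - hB.eigenvalues i := by
        rw [← hab]; simp
      rwa [← this]
    rw [hM.spectrum_real_eq_range_eigenvalues] at h2
    obtain ⟨j, hj⟩ := h2
    have := aux_eig_le H hM j
    simp only [Pi.zero_apply]
    linarith
  have := hp.dotProduct_mulVec_nonneg x
  rw [Algebra.algebraMap_eq_smul_one, sub_mulVec, smul_mulVec, one_mulVec, dotProduct_sub,
    dotProduct_smul] at this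
  simp at this
  linarith

/-- Proposition 1: for `H = A/δ` symmetric with zero diagonal and
unit row absolute sums, `λ_max(H) ≤ 1` and `n·λ_max(H) ≥ max_s sᵀHs = n − 2ε(𝒢)`;
consequently `λ_max(H) > 0`, `π_1 := 1/λ_max(H)` satisfies `1 ≤ π_1`,
`π_1(n − 2ε(𝒢)) ≤ n`, and when `λ_{n−1}(H) > 0`, `π_1 ≤ π_2 := 1/λ_{n−1}(H)`,
so that `1 ≤ π_1 ≤ min{n/(n − 2ε(𝒢)), π_2}` when `n − 2ε(𝒢) > 0`. -/
theorem stmt_9 {n : ℕ} (hn : 2 ≤ n)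
    (A : Matrix (Fin n) (Fin n) ℝ) (hA0 : A ≠ 0) (hA : A.IsSymm)
    (hdiag : ∀ i, A i i = 0)
    (δ : ℝ) (hδ : 0 < δ) (hrow : ∀ i, ∑ j, |A i j| = δ)
    (H : Matrix (Fin n) (Fin n) ℝ) (hH : H = δ⁻¹ • A) :
    lambdaMax H ≤ 1 ∧
    maxCut H ≤ (n : ℝ) * lambdaMax H ∧
    0 < lambdaMax H ∧
    1 ≤ 1 / lambdaMax H ∧
    (1 / lambdaMax H) * maxCut H ≤ (n : ℝ) ∧
    (0 < lambdaSorted H ⟨n - 2, by omega⟩ →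
      1 / lambdaMax H ≤ 1 / lambdaSorted H ⟨n - 2, by omega⟩) ∧
    (0 < lambdaSorted H ⟨n - 2, by omega⟩ → 0 < maxCut H →
      1 / lambdaMax H ≤
        min ((n : ℝ) / maxCut H) (1 / lambdaSorted H ⟨n - 2, by omega⟩)) := by
  have hM : H.IsHermitian := by
    rw [hH]; ext i j
    simp [hA.apply i j]
  have hHd : ∀ i, H i i = 0 := by intro i; simp [hH, hdiag]
  have hHr : ∀ i, ∑ j, |H i j| = 1 := by
    intro i
    simp only [hH, Matrix.smul_apply, smul_eq_mul, abs_mul, ← Finset.mul_sum, hrow,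
      abs_of_pos (inv_pos.mpr hδ)]
    field_simp
  have hH0 : H ≠ 0 := by
    rw [hH]; exact smul_ne_zero (inv_ne_zero hδ.ne') hA0
  haveI : Nonempty (Fin n) := ⟨⟨0, by omega⟩⟩
  have heig : ∀ i, hM.eigenvalues i ≤ 1 := by
    intro i
    have hv : Module.End.HasEigenvalue (Matrix.toLin' H) (hM.eigenvalues i) := by
      rw [Module.End.hasEigenvalue_iff_mem_spectrum, Matrix.spectrum_toLin']
      exact hM.eigenvalues_mem_spectrum_real i
    obtain ⟨k, hk⟩ := eigenvalue_mem_ball hv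
    rw [hHd k, mem_closedBall_zero_iff, Real.norm_eq_abs] at hk
    have h2 : ∑ j ∈ Finset.univ.erase k, ‖H k j‖ ≤ ∑ j, |H k j| :=
      Finset.sum_le_sum_of_subset_of_nonneg (Finset.erase_subset _ _)
        (fun _ _ _ => abs_nonneg _)
    rw [hHr] at h2
    exact (le_abs_self _).trans (hk.trans h2)
  have h1 : lambdaMax H ≤ 1 := by
    refine ciSup_le fun i => ?_
    simp only [lambdaSorted, hM, dite_true, Function.comp_apply]
    exact heig _
  have h2 : maxCut H ≤ (n : ℝ) * lambdaMax H := by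
    refine ciSup_le fun s => ?_
    refine (aux_rayleigh H hM _).trans (le_of_eq ?_)
    have : (fun i => signVal (s i)) ⬝ᵥ (fun i => signVal (s i)) = (n : ℝ) := by
      have : ∀ b, signVal b * signVal b = 1 := by intro b; cases b <;> simp [signVal]
      simp [dotProduct, this]
    rw [this, mul_comm]
  have h3 : 0 < lambdaMax H := by
    by_contra hneg
    push Not at hneg
    apply hH0
    rw [← hM.eigenvalues_eq_zero_iff]
    have ht : ∑ i, hM.eigenvalues i = 0 := by
      have := hM.trace_eq_sum_eigenvalues
      simp [Matrix.trace, hHd] at this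
      exact this.symm
    rw [Finset.sum_eq_zero_iff_of_nonpos (fun i _ => (aux_eig_le H hM i).trans hneg)] at ht
    funext i
    exact ht i (Finset.mem_univ i)
  have h6 : 0 < lambdaSorted H ⟨n - 2, by omega⟩ →
      1 / lambdaMax H ≤ 1 / lambdaSorted H ⟨n - 2, by omega⟩ := fun h =>
    one_div_le_one_div_of_le h (aux_le_max H _)
  refine ⟨h1, h2, h3, ?_, ?_, h6, fun h hc => le_min ?_ (h6 h)⟩
  · rw [le_div_iff₀ h3]; linarith
  · rw [div_mul_eq_mul_div, one_mul, div_le_iff₀ h3]; exact h2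
  · rw [div_le_div_iff₀ h3 hc]; linarith
end

section
/- Let A ∈ ℝ^{n×n} be a nonzero symmetric irreducible matrix with zero diagonal, δ_i := Σ_j |A_{ij}|, Δ := diag(δ_1,…,δ_n), M := Δ^{-1/2} A Δ^{-1/2}, and let ε > 0 satisfy ε·max_i δ_i < 1. Assume either (i) λ_n(M) = 1 (the graph is structurally balanced, λ_1(ℒ) = 0), or (ii) λ_1(M) + λ_n(M) > 0 (equivalently λ_1(ℒ) < 2 − λ_n(ℒ)). Then λ_n(M) > 0, and with π_1 := 1/λ_n(M) the symmetric matrix L_{π_1} := Δ − π_1 A satisfies λ_max(L_{π_1}) < 2/ε; hence the pitchfork threshold π_1 is strictly smaller than the period-doubling threshold π_{1,d} defined by λ_max(Δ − π_{1,d} A) = 2/ε. -/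
open Matrix Filter Set

lemma aux_lmax_lt {n : ℕ} (hn : 0 < n) (H : Matrix (Fin n) (Fin n) ℝ) (hH : H.IsHermitian) (c : ℝ)
    (h : ∀ x : Fin n → ℝ, x ≠ 0 → x ⬝ᵥ H.mulVec x < c * (x ⬝ᵥ x)) : lambdaMax H < c := by
  haveI : Nonempty (Fin n) := ⟨⟨0, hn⟩⟩
  obtain ⟨i, hi⟩ := exists_eq_ciSup_of_finite (f := lambdaSorted H)
  unfold lambdaMax
  rw [← hi]
  unfold lambdaSorted
  rw [dif_pos hH]
  simp only [Function.comp]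
  set k := Tuple.sort hH.eigenvalues i
  have hv := hH.mulVec_eigenvectorBasis k
  have hne : (⇑(hH.eigenvectorBasis k) : Fin n → ℝ) ≠ 0 :=
    (WithLp.ofLp_eq_zero 2).ne.2 <| hH.eigenvectorBasis.orthonormal.ne_zero k
  have h1 := h _ hne
  rw [hv, dotProduct_smul, smul_eq_mul] at h1
  have hpos : 0 < (⇑(hH.eigenvectorBasis k) : Fin n → ℝ) ⬝ᵥ ⇑(hH.eigenvectorBasis k) := by
    rcases (Finset.sum_nonneg fun i _ => mul_self_nonneg
      ((⇑(hH.eigenvectorBasis k) : Fin n → ℝ) i) :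
        0 ≤ (⇑(hH.eigenvectorBasis k) : Fin n → ℝ) ⬝ᵥ ⇑(hH.eigenvectorBasis k)).lt_or_eq with h | h
    · exact h
    · exact absurd (dotProduct_self_eq_zero.1 h.symm) hne
  exact lt_of_mul_lt_mul_right h1 hpos.le

lemma aux_lmin_le {n : ℕ} (H : Matrix (Fin n) (Fin n) ℝ) (hH : H.IsHermitian)
    (x : Fin n → ℝ) : lambdaMin H * (x ⬝ᵥ x) ≤ x ⬝ᵥ H.mulVec x := by
  set c := lambdaMin H with hc
  have hle : ∀ i, c ≤ hH.eigenvalues i := by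
    intro i
    have h1 : lambdaMin H ≤ lambdaSorted H ((Tuple.sort hH.eigenvalues).symm i) :=
      ciInf_le (Set.finite_range _).bddBelow _
    have h2 : lambdaSorted H ((Tuple.sort hH.eigenvalues).symm i) = hH.eigenvalues i := by
      unfold lambdaSorted
      rw [dif_pos hH]
      simp
    rw [h2] at h1
    exact h1
  have hps : (H - algebraMap ℝ (Matrix (Fin n) (Fin n) ℝ) c).PosSemidef := by
    rw [posSemidef_iff_isHermitian_and_spectrum_nonneg]
    constructor
    · apply hH.sub
      rw [Matrix.algebraMap_eq_diagonal]
      exact Matrix.isHermitian_diagonal _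
    · rw [← spectrum.sub_singleton_eq, hH.spectrum_real_eq_range_eigenvalues]
      rintro y hy
      obtain ⟨a, ⟨i, rfl⟩, b, hb, rfl⟩ := Set.mem_sub.1 hy
      have := hle i
      simp only [Set.mem_singleton_iff] at hb
      show (0:ℝ) ≤ _
      linarith
  have := hps.dotProduct_mulVec_nonneg x
  rw [Matrix.sub_mulVec, dotProduct_sub, Algebra.algebraMap_eq_smul_one, smul_mulVec, one_mulVec,
    dotProduct_smul, star_trivial, smul_eq_mul] at this
  linarith

lemma aux_bal {n : ℕ} (A : Matrix (Fin n) (Fin n) ℝ) (hA : A.IsSymm)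
    (δ : Fin n → ℝ) (hδ : ∀ i, δ i = ∑ j, |A i j|) (x : Fin n → ℝ) :
    -(x ⬝ᵥ A.mulVec x) ≤ ∑ i, δ i * x i ^ 2 := by
  have e1 : x ⬝ᵥ A.mulVec x = ∑ i, ∑ j, x i * (A i j * x j) := by
    simp [dotProduct, mulVec, Finset.mul_sum]
  have e2 : ∑ i, δ i * x i ^ 2 = ∑ i, ∑ j, |A i j| * x i ^ 2 := by
    simp [hδ, Finset.sum_mul]
  have e3 : ∑ i, δ i * x i ^ 2 = ∑ i, ∑ j, |A i j| * x j ^ 2 := by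
    rw [e2, Finset.sum_comm]
    refine Finset.sum_congr rfl fun i _ => Finset.sum_congr rfl fun j _ => ?_
    rw [hA.apply i j]
  have key : -(2 * (x ⬝ᵥ A.mulVec x)) ≤ ∑ i, ∑ j, (|A i j| * x i ^ 2 + |A i j| * x j ^ 2) := by
    rw [e1, Finset.mul_sum, ← Finset.sum_neg_distrib]
    refine Finset.sum_le_sum fun i _ => ?_
    rw [Finset.mul_sum, ← Finset.sum_neg_distrib]
    refine Finset.sum_le_sum fun j _ => ?_
    rcases abs_cases (A i j) with ⟨h, h'⟩ | ⟨h, h'⟩ <;> rw [h]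
    · nlinarith [mul_nonneg h' (sq_nonneg (x i + x j))]
    · nlinarith [mul_nonneg (neg_pos.2 h').le (sq_nonneg (x i - x j))]
  simp only [Finset.sum_add_distrib] at key
  rw [← e2, ← e3] at key
  linarith

/-- Proposition 2: assume `ε·max_i δ_i < 1` and either the graph is
structurally balanced (`λ_n(M) = 1`) or `λ_1(M) + λ_n(M) > 0`. Then `λ_n(M) > 0`
and, with `π_1 = 1/λ_n(M)`, `λ_max(Δ − π_1 A) < 2/ε`; hence `π_1 < π_{1,d}` for any
`π_{1,d} > 0` with `λ_max(Δ − π_{1,d} A) = 2/ε`. -/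
theorem stmt_10 {n : ℕ} (hn : 2 ≤ n)
    (A : Matrix (Fin n) (Fin n) ℝ) (hA0 : A ≠ 0) (hA : A.IsSymm)
    (hdiag : ∀ i, A i i = 0)
    (hirr : ¬ ∃ P : Fin n → Prop, (∃ i, P i) ∧ (∃ i, ¬ P i) ∧
      ∀ i j, P i → ¬ P j → A i j = 0)
    (δ : Fin n → ℝ) (hδ : ∀ i, δ i = ∑ j, |A i j|)
    (M : Matrix (Fin n) (Fin n) ℝ)
    (hM : M = Matrix.diagonal (fun i => (Real.sqrt (δ i))⁻¹) * A *
      Matrix.diagonal (fun i => (Real.sqrt (δ i))⁻¹))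
    (ε : ℝ) (hε : 0 < ε) (hεδ : ∀ i, ε * δ i < 1)
    (hcase : lambdaMax M = 1 ∨ 0 < lambdaMin M + lambdaMax M) :
    0 < lambdaMax M ∧
    lambdaMax (Matrix.diagonal δ - (1 / lambdaMax M) • A) < 2 / ε ∧
    ∀ p1d : ℝ, 0 < p1d → lambdaMax (Matrix.diagonal δ - p1d • A) = 2 / ε →
      1 / lambdaMax M < p1d := by
  have hn0 : 0 < n := by omega
  haveI : Nonempty (Fin n) := ⟨⟨0, hn0⟩⟩
  have hδpos : ∀ i, 0 < δ i := by
    intro i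
    have h0 : 0 ≤ δ i := by rw [hδ]; exact Finset.sum_nonneg fun _ _ => abs_nonneg _
    rcases h0.lt_or_eq with h | h
    · exact h
    · exfalso
      rw [hδ] at h
      have hz := (Finset.sum_eq_zero_iff_of_nonneg fun j _ => abs_nonneg (A i j)).1 h.symm
      haveI : Nontrivial (Fin n) := Fin.nontrivial_iff_two_le.2 hn
      obtain ⟨j, hj⟩ := exists_ne i
      refine hirr ⟨fun k => k = i, ⟨i, rfl⟩, ⟨j, hj⟩, ?_⟩
      intro a b ha _
      subst ha
      exact abs_eq_zero.1 (hz b (Finset.mem_univ _))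
  have hAH : A.IsHermitian := by
    ext i j
    simp [hA.apply i j]
  have hMe : ∀ i j, M i j = (Real.sqrt (δ i))⁻¹ * A i j * (Real.sqrt (δ j))⁻¹ := by
    intro i j
    rw [hM, Matrix.mul_diagonal, Matrix.diagonal_mul]
  have hMH : M.IsHermitian := by
    ext i j
    simp only [conjTranspose_apply, star_trivial, hMe, hA.apply i j]
    ring
  have hlm : lambdaMin M ≤ lambdaMax M :=
    (ciInf_le (Set.finite_range _).bddBelow ⟨0, hn0⟩).trans
      (le_ciSup (f := lambdaSorted M) (Set.finite_range _).bddAbove ⟨0, hn0⟩)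
  have hpos : 0 < lambdaMax M := by
    rcases hcase with h | h
    · rw [h]; exact one_pos
    · linarith
  have hS0 : ∀ x : Fin n → ℝ, 0 ≤ ∑ i, δ i * x i ^ 2 := fun x =>
    Finset.sum_nonneg fun i _ => mul_nonneg (hδpos i).le (sq_nonneg _)
  have hkey : ∀ x : Fin n → ℝ, -(x ⬝ᵥ A.mulVec x) ≤ lambdaMax M * ∑ i, δ i * x i ^ 2 := by
    intro x
    rcases hcase with h | h
    · rw [h, one_mul]; exact aux_bal A hA δ hδ x
    · have h1 := aux_lmin_le M hMH (fun i => Real.sqrt (δ i) * x i)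
      have e1 : (fun i => Real.sqrt (δ i) * x i) ⬝ᵥ (fun i => Real.sqrt (δ i) * x i)
          = ∑ i, δ i * x i ^ 2 := by
        refine Finset.sum_congr rfl fun i _ => ?_
        have := Real.sq_sqrt (hδpos i).le
        calc _ = (Real.sqrt (δ i)) ^ 2 * x i ^ 2 := by ring
          _ = _ := by rw [this]
      have e2 : (fun i => Real.sqrt (δ i) * x i) ⬝ᵥ M.mulVec (fun i => Real.sqrt (δ i) * x i)
          = x ⬝ᵥ A.mulVec x := by
        simp only [dotProduct, mulVec, Finset.mul_sum, hMe]
        refine Finset.sum_congr rfl fun i _ => Finset.sum_congr rfl fun j _ => ?_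
        have hi := (Real.sqrt_pos.2 (hδpos i)).ne'
        have hj := (Real.sqrt_pos.2 (hδpos j)).ne'
        field_simp
      rw [e1, e2] at h1
      nlinarith [hS0 x]
  have main : ∀ p : ℝ, 0 < p → p ≤ 1 / lambdaMax M →
      lambdaMax (Matrix.diagonal δ - p • A) < 2 / ε := by
    intro p hp hple
    have hpl : p * lambdaMax M ≤ 1 := (le_div_iff₀ hpos).1 hple
    apply aux_lmax_lt hn0
    · apply (Matrix.isHermitian_diagonal _).sub
      ext i j
      simp [hA.apply i j]
    · intro x hx
      have e : x ⬝ᵥ (Matrix.diagonal δ - p • A).mulVec x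
          = ∑ i, δ i * x i ^ 2 + p * (-(x ⬝ᵥ A.mulVec x)) := by
        rw [Matrix.sub_mulVec, dotProduct_sub, smul_mulVec, dotProduct_smul, smul_eq_mul]
        have : x ⬝ᵥ (Matrix.diagonal δ).mulVec x = ∑ i, δ i * x i ^ 2 := by
          refine Finset.sum_congr rfl fun i _ => ?_
          rw [mulVec_diagonal]; ring
        rw [this]; ring
      have h1 : p * (-(x ⬝ᵥ A.mulVec x)) ≤ ∑ i, δ i * x i ^ 2 := by
        have a1 := mul_le_mul_of_nonneg_left (hkey x) hp.le
        have a2 := mul_le_mul_of_nonneg_right hpl (hS0 x)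
        linarith
      have h2 : ∑ i, δ i * x i ^ 2 < 1 / ε * (x ⬝ᵥ x) := by
        rw [dotProduct, Finset.mul_sum]
        have hlt : ∀ i, δ i < 1 / ε := fun i => by
          rw [lt_div_iff₀ hε, mul_comm]; exact hεδ i
        obtain ⟨k, hk⟩ := Function.ne_iff.1 hx
        apply Finset.sum_lt_sum
        · intro i _
          rw [← pow_two]
          exact mul_le_mul_of_nonneg_right (hlt i).le (sq_nonneg _)
        · refine ⟨k, Finset.mem_univ _, ?_⟩
          rw [← pow_two]
          exact mul_lt_mul_of_pos_right (hlt k) (by have hk2 : x k ≠ 0 := hk; positivity)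
      rw [e]
      have : 2 / ε * (x ⬝ᵥ x) = 2 * (1 / ε * (x ⬝ᵥ x)) := by ring
      linarith
  refine ⟨hpos, main _ (by positivity) le_rfl, ?_⟩
  intro p hp heq
  by_contra hcon
  exact absurd heq (main p hp (not_lt.1 hcon)).ne
end

section
/- Let A ∈ ℝ^{n×n} be symmetric with zero diagonal and no zero row, δ_i := Σ_j |A_{ij}|, Δ := diag(δ_1,…,δ_n), let ψ_1,…,ψ_n satisfy (A.1)–(A.4), and let π > 0. If there exists x* ≠ 0 with Δx* = πAψ(x*) (a nontrivial fixed point of the discrete-time map x ↦ (I − εΔ)x + επAψ(x) for any ε > 0), then the symmetric matrix L_π := Δ − πA is not positive semidefinite, i.e. λ_min(Δ − πA) < 0; equivalently π > π_1 = 1/λ_max(Δ^{-1/2}AΔ^{-1/2}). -/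
open Matrix Filter Set

lemma aux_sig_pos_s11 {ψ : ℝ → ℝ} (h : IsSigmoid ψ) {y : ℝ} (hy : 0 < y) : 0 < ψ y ∧ ψ y < y := by
  have h0 : ψ 0 = 0 := by
    have := h.odd 0
    simp only [neg_zero] at this
    linarith
  have hd : Differentiable ℝ ψ := h.contDiff.differentiable (by norm_num)
  have hc : Continuous (deriv ψ) := h.contDiff.continuous_deriv (by norm_num)
  have hm : StrictMono ψ := strictMono_of_deriv_pos h.deriv_pos
  refine ⟨by simpa [h0] using hm hy, ?_⟩
  have hanti := h.strictConcaveOn.strictAntiOn_deriv (fun x _ => hd x)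
  obtain ⟨c, hcm, hce⟩ := exists_deriv_eq_slope ψ hy hd.continuous.continuousOn
    hd.differentiableOn
  have hc0 : 0 < c := hcm.1
  have h1 : deriv ψ c < deriv ψ (c/2) :=
    hanti (show 0 < c/2 by linarith) hc0 (by linarith)
  have h2 : deriv ψ (c/2) ≤ 1 := by
    have ht : Tendsto (deriv ψ) (nhdsWithin 0 (Ioi 0)) (nhds 1) := by
      have := hc.tendsto 0
      rw [h.deriv_zero] at this
      exact this.mono_left nhdsWithin_le_nhds
    refine ge_of_tendsto ht ?_
    filter_upwards [Ioo_mem_nhdsGT (show (0:ℝ) < c/2 by linarith)] with t ht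
    exact (hanti ht.1 (show 0 < c/2 by linarith) ht.2).le
  have h3 : (ψ y - ψ 0) / (y - 0) < 1 := by rw [← hce]; linarith
  rw [h0, sub_zero, sub_zero, div_lt_one hy] at h3
  exact h3

lemma aux_sig_s11 {ψ : ℝ → ℝ} (h : IsSigmoid ψ) {y : ℝ} (hy : y ≠ 0) : ψ y * (ψ y - y) < 0 := by
  rcases lt_or_gt_of_ne hy with hy | hy
  · have := aux_sig_pos_s11 h (y := -y) (by linarith)
    rw [h.odd] at this
    nlinarith [this.1, this.2]
  · have := aux_sig_pos_s11 h hy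
    nlinarith [this.1, this.2]

lemma aux_sig_zero {ψ : ℝ → ℝ} (h : IsSigmoid ψ) : ψ 0 = 0 := by
  have := h.odd 0
  simp only [neg_zero] at this
  linarith

lemma aux_max {n : ℕ} {M : Matrix (Fin n) (Fin n) ℝ} (hM : M.IsHermitian) (v : Fin n → ℝ) :
    v ⬝ᵥ M *ᵥ v ≤ lambdaMax M * (v ⬝ᵥ v) := by
  have hle : ∀ i, hM.eigenvalues i ≤ lambdaMax M := by
    intro i
    have := le_ciSup (f := lambdaSorted M) (Set.finite_range _).bddAbove
      ((Tuple.sort hM.eigenvalues).symm i)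
    have he : lambdaSorted M ((Tuple.sort hM.eigenvalues).symm i) = hM.eigenvalues i := by
      rw [lambdaSorted, dif_pos hM, Function.comp_apply, Equiv.apply_symm_apply]
    rw [he] at this
    exact this
  have hH : (algebraMap ℝ (Matrix (Fin n) (Fin n) ℝ) (lambdaMax M) - M).IsHermitian := by
    refine IsHermitian.sub ?_ hM
    rw [Matrix.algebraMap_eq_diagonal]
    exact Matrix.isHermitian_diagonal _
  have hP := hH.posSemidef_iff_eigenvalues_nonneg.2 (by
    intro i
    have := hH.eigenvalues_mem_spectrum_real i
    rw [← spectrum.singleton_sub_eq, hM.spectrum_real_eq_range_eigenvalues] at this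
    obtain ⟨a, rfl, b, ⟨j, rfl⟩, hb⟩ := this
    have := hle j
    simp only [Pi.zero_apply]
    rw [← hb]
    simpa using this)
  have := hP.dotProduct_mulVec_nonneg v
  rw [Matrix.sub_mulVec, dotProduct_sub, Algebra.algebraMap_eq_smul_one, Matrix.smul_mulVec,
    Matrix.one_mulVec, dotProduct_smul] at this
  simpa using this

lemma aux_min {n : ℕ} {M : Matrix (Fin n) (Fin n) ℝ} (hM : M.IsHermitian) (v : Fin n → ℝ)
    (hv : v ⬝ᵥ M *ᵥ v < 0) : lambdaMin M < 0 := by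
  by_contra! h
  have hle : ∀ i, lambdaMin M ≤ hM.eigenvalues i := by
    intro i
    have := ciInf_le (f := lambdaSorted M) (Set.finite_range _).bddBelow
      ((Tuple.sort hM.eigenvalues).symm i)
    have he : lambdaSorted M ((Tuple.sort hM.eigenvalues).symm i) = hM.eigenvalues i := by
      rw [lambdaSorted, dif_pos hM, Function.comp_apply, Equiv.apply_symm_apply]
    rw [he] at this
    exact this
  have hP := hM.posSemidef_iff_eigenvalues_nonneg.2 (fun i => h.trans (hle i))
  have := hP.dotProduct_mulVec_nonneg v
  simp only [star_trivial] at this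
  linarith

/-- Lemma 5: if `x* ≠ 0` solves `Δx* = πAψ(x*)` (a nontrivial
fixed point of the discrete-time map), then `L_π = Δ − πA` is not positive
semidefinite, i.e. `λ_min(Δ − πA) < 0`; equivalently `π > π_1 = 1/λ_max(M)`. -/
theorem stmt_11 {n : ℕ} (hn : 2 ≤ n)
    (A : Matrix (Fin n) (Fin n) ℝ) (hA : A.IsSymm)
    (hdiag : ∀ i, A i i = 0) (hrow : ∀ i, ∃ j, A i j ≠ 0)
    (δ : Fin n → ℝ) (hδ : ∀ i, δ i = ∑ j, |A i j|)
    (M : Matrix (Fin n) (Fin n) ℝ)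
    (hM : M = Matrix.diagonal (fun i => (Real.sqrt (δ i))⁻¹) * A *
      Matrix.diagonal (fun i => (Real.sqrt (δ i))⁻¹))
    (ψ : Fin n → ℝ → ℝ) (hψ : ∀ i, IsSigmoid (ψ i))
    (p : ℝ) (hp : 0 < p)
    (xs : Fin n → ℝ) (hxs : xs ≠ 0)
    (heq : (Matrix.diagonal δ).mulVec xs = p • A.mulVec (fun i => ψ i (xs i))) :
    lambdaMin (Matrix.diagonal δ - p • A) < 0 ∧ 1 < p * lambdaMax M := by
  have hδ0 : ∀ i, 0 < δ i := by
    intro i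
    obtain ⟨j, hj⟩ := hrow i
    rw [hδ]
    exact Finset.sum_pos' (fun _ _ => abs_nonneg _) ⟨j, Finset.mem_univ _, abs_pos.2 hj⟩
  have hAH : A.IsHermitian := by
    rw [Matrix.IsHermitian, Matrix.conjTranspose_eq_transpose_of_trivial]; exact hA
  have hLH : (Matrix.diagonal δ - p • A).IsHermitian := by
    refine IsHermitian.sub (Matrix.isHermitian_diagonal _) ?_
    rw [Matrix.IsHermitian, Matrix.conjTranspose_smul, hAH.eq]; simp
  have hMH : M.IsHermitian := by
    rw [hM, Matrix.IsHermitian, Matrix.conjTranspose_mul, Matrix.conjTranspose_mul, hAH.eq,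
      (Matrix.isHermitian_diagonal _).eq, Matrix.mul_assoc]
  set v : Fin n → ℝ := fun i => ψ i (xs i) with hv
  have key : v ⬝ᵥ (Matrix.diagonal δ - p • A) *ᵥ v < 0 := by
    rw [Matrix.sub_mulVec, Matrix.smul_mulVec, ← heq, ← Matrix.mulVec_sub]
    simp only [dotProduct, Matrix.mulVec_diagonal, Pi.sub_apply]
    obtain ⟨i, hi⟩ := Function.ne_iff.1 hxs
    have hz : ∀ i, xs i ≠ 0 → v i * (δ i * (v i - xs i)) < 0 := by
      intro i hi
      have := mul_neg_of_pos_of_neg (hδ0 i) (aux_sig_s11 (hψ i) hi)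
      simp only [hv]
      linarith
    refine Finset.sum_neg' (fun j _ => ?_) ⟨i, Finset.mem_univ _, hz i hi⟩
    by_cases hj : xs j = 0
    · simp [hv, hj, aux_sig_zero (hψ j)]
    · exact (hz j hj).le
  refine ⟨aux_min hLH v key, ?_⟩
  set w : Fin n → ℝ := fun i => Real.sqrt (δ i) * v i with hw
  have hs : ∀ i, Real.sqrt (δ i) ≠ 0 := fun i => (Real.sqrt_pos.2 (hδ0 i)).ne'
  have hDw : (Matrix.diagonal (fun i => (Real.sqrt (δ i))⁻¹)) *ᵥ w = v := by
    ext i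
    simp [Matrix.mulVec_diagonal, hw, hs i]
  have hww : w ⬝ᵥ w = v ⬝ᵥ (Matrix.diagonal δ) *ᵥ v := by
    simp only [dotProduct, Matrix.mulVec_diagonal, hw]
    refine Finset.sum_congr rfl fun i _ => ?_
    have := Real.mul_self_sqrt (hδ0 i).le
    linear_combination (v i * v i) * this
  have hMw : w ⬝ᵥ M *ᵥ w = v ⬝ᵥ A *ᵥ v := by
    rw [hM, ← Matrix.mulVec_mulVec, hDw, ← Matrix.mulVec_mulVec]
    simp only [dotProduct, Matrix.mulVec_diagonal, hw]
    refine Finset.sum_congr rfl fun i _ => ?_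
    have := hs i
    field_simp
  have h1 := aux_max hMH w
  rw [Matrix.sub_mulVec, Matrix.smul_mulVec, dotProduct_sub, dotProduct_smul, ← hww, ← hMw,
    smul_eq_mul] at key
  have h2 : 0 ≤ w ⬝ᵥ w := Finset.sum_nonneg fun i _ => mul_self_nonneg _
  by_contra! h
  nlinarith [mul_le_mul_of_nonneg_left h1 hp.le, mul_le_mul_of_nonneg_right h h2]
end

section
/- Let A ∈ ℝ^{n×n} be symmetric with zero diagonal and no zero row, δ_i := Σ_j |A_{ij}|, Δ := diag(δ_1,…,δ_n), let ψ_1,…,ψ_n satisfy (A.1)–(A.4), let π > 0, and let ε > 0 satisfy ε·max_i δ_i < 2. If the map F(x) := (I − εΔ)x + επAψ(x) admits a period-2 orbit, i.e. there exist x ≠ y in ℝ^n with y = F(x) and x = F(y), then λ_max(Δ − πA) > 2/ε; equivalently π > π_{1,d}, where π_{1,d} is defined by λ_max(Δ − π_{1,d}A) = 2/ε. -/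
open Matrix Filter Set

lemma sig_deriv_lt {f : ℝ → ℝ} (h : IsSigmoid f) {t : ℝ} (ht : 0 < t) : deriv f t < 1 := by
  have hd : Differentiable ℝ f := h.contDiff.differentiable (by norm_num)
  have hc : Continuous (deriv f) := h.contDiff.continuous_deriv (by norm_num)
  have hanti : ∀ a b : ℝ, 0 < a → a < b → deriv f b < deriv f a := by
    intro a b ha hab
    have h1 := h.strictConcaveOn.slope_lt_deriv (x := a) (y := b) ha (ha.trans hab) hab (hd a)
    have h2 := h.strictConcaveOn.deriv_lt_slope (x := a) (y := b) ha (ha.trans hab) hab (hd b)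
    exact h2.trans h1
  have h2 : deriv f (t/2) ≤ 1 := by
    rw [← h.deriv_zero]
    have hT : Tendsto (deriv f) (nhdsWithin 0 (Ioi 0)) (nhds (deriv f 0)) :=
      (hc.tendsto 0).mono_left nhdsWithin_le_nhds
    refine ge_of_tendsto hT ?_
    filter_upwards [Ioo_mem_nhdsGT (show (0:ℝ) < t/2 by linarith)] with s hs
    exact (hanti s (t/2) hs.1 hs.2).le
  exact (hanti (t/2) t (by linarith) (by linarith)).trans_le h2

lemma sig_strict {f : ℝ → ℝ} (h : IsSigmoid f) : StrictMono (fun t => t - f t) := by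
  have hd : Differentiable ℝ f := h.contDiff.differentiable (by norm_num)
  apply strictMono_of_odd_strictMonoOn_nonneg
  · intro t; simp only [h.odd]; ring
  · apply strictMonoOn_of_deriv_pos (convex_Ici 0)
    · exact (continuous_id.sub h.contDiff.continuous).continuousOn
    · intro t ht
      rw [interior_Ici] at ht
      have : deriv (fun t => t - f t) t = 1 - deriv f t :=
        ((hasDerivAt_id t).sub (hd t).hasDerivAt).deriv
      rw [this]
      linarith [sig_deriv_lt h ht]

lemma sig_ineq {f : ℝ → ℝ} (h : IsSigmoid f) {a b : ℝ} (hab : a ≠ b) :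
    (f a - f b)^2 < (f a - f b) * (a - b) := by
  have h1 := sig_strict h
  have h2 : StrictMono f := strictMono_of_deriv_pos h.deriv_pos
  rcases lt_or_gt_of_ne hab with hl | hl
  · have e1 := h1 hl
    have e2 := h2 hl
    simp only at e1
    nlinarith
  · have e1 := h1 hl
    have e2 := h2 hl
    simp only at e1
    nlinarith

lemma lt_lambdaMax {n : ℕ} {M : Matrix (Fin n) (Fin n) ℝ} (hM : M.IsHermitian) {c : ℝ}
    (v : Fin n → ℝ) (hv : c * (v ⬝ᵥ v) < v ⬝ᵥ M *ᵥ v) : c < lambdaMax M := by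
  by_contra hcon
  push Not at hcon
  have hev : ∀ i, hM.eigenvalues i ≤ c := by
    intro i
    refine le_trans ?_ hcon
    have := le_ciSup (f := lambdaSorted M) (Set.finite_range _).bddAbove
      ((Tuple.sort hM.eigenvalues).symm i)
    have e : lambdaSorted M ((Tuple.sort hM.eigenvalues).symm i) = hM.eigenvalues i := by
      rw [lambdaSorted, dif_pos hM, Function.comp_apply, Equiv.apply_symm_apply]
    rw [e] at this
    exact this
  have hps : (algebraMap ℝ (Matrix (Fin n) (Fin n) ℝ) c - M).PosSemidef := by
    rw [Matrix.posSemidef_iff_isHermitian_and_spectrum_nonneg]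
    refine ⟨?_, ?_⟩
    · rw [Matrix.algebraMap_eq_diagonal]
      exact (Matrix.isHermitian_diagonal _).sub hM
    · rw [← spectrum.singleton_sub_eq, hM.spectrum_real_eq_range_eigenvalues]
      rintro _ ⟨_, rfl, _, ⟨i, rfl⟩, rfl⟩
      simpa using hev i
  have := hps.dotProduct_mulVec_nonneg v
  rw [Algebra.algebraMap_eq_smul_one, Matrix.sub_mulVec, Matrix.smul_mulVec, Matrix.one_mulVec,
    dotProduct_sub, dotProduct_smul] at this
  simp only [star_trivial, smul_eq_mul] at this
  linarith

/-- Lemma 6: if `ε·max_i δ_i < 2` and the discrete-time map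
`F(x) = (I − εΔ)x + επAψ(x)` admits a period-2 orbit `x ≠ y`, `y = F(x)`,
`x = F(y)`, then `λ_max(Δ − πA) > 2/ε`; equivalently `π > π_{1,d}`, where
`π_{1,d}` is defined by `λ_max(Δ − π_{1,d}A) = 2/ε`. -/
theorem stmt_12 {n : ℕ} (hn : 2 ≤ n)
    (A : Matrix (Fin n) (Fin n) ℝ) (hA : A.IsSymm)
    (hdiag : ∀ i, A i i = 0) (hrow : ∀ i, ∃ j, A i j ≠ 0)
    (δ : Fin n → ℝ) (hδ : ∀ i, δ i = ∑ j, |A i j|)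
    (ψ : Fin n → ℝ → ℝ) (hψ : ∀ i, IsSigmoid (ψ i))
    (p : ℝ) (hp : 0 < p)
    (ε : ℝ) (hε : 0 < ε) (hεδ : ∀ i, ε * δ i < 2)
    (F : (Fin n → ℝ) → Fin n → ℝ)
    (hF : ∀ x, F x = ((1 : Matrix (Fin n) (Fin n) ℝ) - ε • Matrix.diagonal δ).mulVec x +
      (ε * p) • A.mulVec (fun i => ψ i (x i)))
    (x y : Fin n → ℝ) (hxy : x ≠ y) (hy : y = F x) (hx : x = F y) :
    2 / ε < lambdaMax (Matrix.diagonal δ - p • A) ∧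
    ∀ p1d : ℝ, 0 < p1d → lambdaMax (Matrix.diagonal δ - p1d • A) = 2 / ε →
      p1d < p := by
  set w : Fin n → ℝ := fun i => ψ i (x i) - ψ i (y i) with hw
  have hAw : ∀ i, (2 - ε * δ i) * (x i - y i) = -(ε * p) * (A *ᵥ w) i := by
    intro i
    have e1 := congrFun hy i
    have e2 := congrFun hx i
    rw [hF] at e1 e2
    have e3 : w = (fun i => ψ i (x i)) - (fun i => ψ i (y i)) := rfl
    rw [e3, Matrix.mulVec_sub]
    simp only [Matrix.sub_mulVec, Matrix.one_mulVec, Matrix.smul_mulVec, Pi.add_apply,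
      Pi.sub_apply, Pi.smul_apply, smul_eq_mul, Matrix.mulVec_diagonal] at e1 e2 ⊢
    linear_combination e2 - e1
  have hsum : ∑ i, (2 - ε * δ i) * (w i)^2 < -(ε * p) * (w ⬝ᵥ A *ᵥ w) := by
    have : -(ε * p) * (w ⬝ᵥ A *ᵥ w) = ∑ i, (2 - ε * δ i) * (w i * (x i - y i)) := by
      rw [dotProduct, Finset.mul_sum]
      refine Finset.sum_congr rfl fun i _ => ?_
      linear_combination - w i * hAw i
    rw [this]
    obtain ⟨j, hj⟩ := Function.ne_iff.mp hxy
    refine Finset.sum_lt_sum (fun i _ => ?_) ⟨j, Finset.mem_univ _, ?_⟩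
    · have := hεδ i
      refine mul_le_mul_of_nonneg_left ?_ (by linarith)
      by_cases h : x i = y i
      · simp [hw, h]
      · exact (sig_ineq (hψ i) h).le
    · have := hεδ j
      exact mul_lt_mul_of_pos_left (sig_ineq (hψ j) hj) (by linarith)
  have hnn : 0 ≤ ∑ i, (2 - ε * δ i) * (w i)^2 := by
    refine Finset.sum_nonneg fun i _ => mul_nonneg ?_ (sq_nonneg _)
    linarith [hεδ i]
  have hneg : w ⬝ᵥ A *ᵥ w < 0 := by
    by_contra hc
    push Not at hc
    have := mul_nonneg (mul_pos hε hp).le hc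
    linarith
  have key : ∀ q, p ≤ q → 2 / ε < lambdaMax (Matrix.diagonal δ - q • A) := by
    intro q hq
    have hH : (Matrix.diagonal δ - q • A).IsHermitian := by
      refine (Matrix.isHermitian_diagonal _).sub ?_
      rw [Matrix.IsHermitian, Matrix.conjTranspose_eq_transpose_of_trivial,
        Matrix.transpose_smul, hA.eq]
    refine lt_lambdaMax hH w ?_
    have e1 : ∑ i, (2 - ε * δ i) * (w i)^2
        = 2 * (w ⬝ᵥ w) - ε * (w ⬝ᵥ Matrix.diagonal δ *ᵥ w) := by
      simp only [dotProduct, Matrix.mulVec_diagonal, Finset.mul_sum, ← Finset.sum_sub_distrib]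
      exact Finset.sum_congr rfl fun i _ => by ring
    rw [Matrix.sub_mulVec, Matrix.smul_mulVec, dotProduct_sub, dotProduct_smul, smul_eq_mul,
      div_mul_eq_mul_div, div_lt_iff₀ hε]
    have e2 : ε * (q - p) * (w ⬝ᵥ A *ᵥ w) ≤ 0 :=
      mul_nonpos_of_nonneg_of_nonpos (mul_nonneg hε.le (by linarith)) hneg.le
    rw [e1] at hsum
    linarith
  refine ⟨key p le_rfl, fun q _ hq => ?_⟩
  by_contra hc
  push Not at hc
  exact absurd hq (key q hc).ne'
end

section
/- Let A ∈ ℝ^{n×n} be symmetric, let D = diag(d_1,…,d_n) and S = diag(s_1,…,s_n) be diagonal matrices with strictly positive diagonal entries, and set B := DA. Then the matrices BS, SB and S^{1/2}BS^{1/2} all have the same characteristic polynomial as the symmetric matrix S^{1/2}D^{1/2}AD^{1/2}S^{1/2}, and for each k ∈ {1,…,n} there exists θ_k ∈ [min_i s_i, max_i s_i] such that the k-th smallest eigenvalue satisfies λ_k(S^{1/2}D^{1/2}AD^{1/2}S^{1/2}) = θ_k · λ_k(D^{1/2}AD^{1/2}); equivalently λ_k(BS) = λ_k(SB) = θ_k·λ_k(B),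 eigenvalues in nondecreasing order. -/
open Matrix Filter Set

theorem aux_spec_s15 {n : ℕ} (M : Matrix (Fin n) (Fin n) ℝ) (hM : M.IsHermitian) :
    Monotone (lambdaSorted M) ∧ ∃ U : Matrix (Fin n) (Fin n) ℝ,
      (∀ x : Fin n → ℝ, x ⬝ᵥ x = ∑ i, (U *ᵥ x) i ^ 2) ∧
      (∀ x : Fin n → ℝ, x ⬝ᵥ (M *ᵥ x) = ∑ i, lambdaSorted M i * (U *ᵥ x) i ^ 2) := by
  have hl : lambdaSorted M = hM.eigenvalues ∘ ⇑(Tuple.sort hM.eigenvalues) := by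
    rw [lambdaSorted, dif_pos hM]
  rw [hl]
  refine ⟨Tuple.monotone_sort _, ?_⟩
  set V : Matrix (Fin n) (Fin n) ℝ := (hM.eigenvectorUnitary : Matrix (Fin n) (Fin n) ℝ) with hV
  have hVV : V * Vᵀ = 1 := by
    have := Unitary.coe_mul_star_self hM.eigenvectorUnitary
    simpa [Matrix.star_eq_conjTranspose] using this
  have hsp : M = V * Matrix.diagonal hM.eigenvalues * Vᵀ := by
    have := hM.spectral_theorem
    rw [Unitary.conjStarAlgAut_apply] at this
    simpa [Matrix.star_eq_conjTranspose, Function.comp_def] using this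
  refine ⟨Vᵀ.submatrix (Tuple.sort hM.eigenvalues) id, ?_, ?_⟩
  · intro x
    have h1 : x ⬝ᵥ x = (Vᵀ *ᵥ x) ⬝ᵥ (Vᵀ *ᵥ x) := by
      rw [Matrix.dotProduct_mulVec, Matrix.vecMul_transpose, Matrix.mulVec_mulVec, hVV,
        Matrix.one_mulVec]
    rw [h1, dotProduct, ← Equiv.sum_comp (Tuple.sort hM.eigenvalues)]
    refine Finset.sum_congr rfl fun i _ => ?_
    rw [← sq]; rfl
  · intro x
    have h1 : x ⬝ᵥ (M *ᵥ x) =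
        (Vᵀ *ᵥ x) ⬝ᵥ (Matrix.diagonal hM.eigenvalues *ᵥ (Vᵀ *ᵥ x)) := by
      conv_lhs => rw [hsp]
      rw [← Matrix.mulVec_mulVec, ← Matrix.mulVec_mulVec, Matrix.dotProduct_mulVec x V,
        ← Matrix.mulVec_transpose]
    rw [h1, dotProduct, ← Equiv.sum_comp (Tuple.sort hM.eigenvalues)]
    refine Finset.sum_congr rfl fun i _ => ?_
    rw [Matrix.mulVec_diagonal]
    change _ = _ * ((Vᵀ *ᵥ x) _) ^ 2
    simp only [Function.comp]
    ring

theorem aux_key {n : ℕ} (M N P : Matrix (Fin n) (Fin n) ℝ) (hM : M.IsHermitian)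
    (hN : N.IsHermitian) (hP : N = Pᵀ * M * P) (k : Fin n) :
    ∃ x : Fin n → ℝ, x ≠ 0 ∧
      lambdaSorted N k * (x ⬝ᵥ x) ≤ lambdaSorted M k * ((P *ᵥ x) ⬝ᵥ (P *ᵥ x)) := by
  obtain ⟨mM, U, hU1, hU2⟩ := aux_spec_s15 M hM
  obtain ⟨mN, W, hW1, hW2⟩ := aux_spec_s15 N hN
  let f : (Fin n → ℝ) →ₗ[ℝ] ({i : Fin n // i ≠ k} → ℝ) :=
    LinearMap.pi fun i => if i.1 < k then (LinearMap.proj i.1).comp W.mulVecLin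
      else (LinearMap.proj i.1).comp (U * P).mulVecLin
  have hker : LinearMap.ker f ≠ ⊥ := by
    apply LinearMap.ker_ne_bot_of_finrank_lt
    have := k.pos
    simp [Fintype.card_subtype_compl]
    omega
  obtain ⟨x, hx, hx0⟩ := Submodule.exists_mem_ne_zero_of_ne_bot hker
  have hf : ∀ i : {i : Fin n // i ≠ k}, f x i = 0 := fun i => by
    rw [LinearMap.mem_ker.1 hx]; rfl
  have hWx : ∀ i, i < k → (W *ᵥ x) i = 0 := fun i hi => by
    have := hf ⟨i, hi.ne⟩
    simpa [f, hi] using this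
  have hUx : ∀ i, k < i → (U *ᵥ (P *ᵥ x)) i = 0 := fun i hi => by
    have := hf ⟨i, hi.ne'⟩
    simpa [f, hi.not_gt] using this
  refine ⟨x, hx0, ?_⟩
  have e : x ⬝ᵥ (N *ᵥ x) = (P *ᵥ x) ⬝ᵥ (M *ᵥ (P *ᵥ x)) := by
    rw [hP, ← Matrix.mulVec_mulVec, ← Matrix.mulVec_mulVec, Matrix.dotProduct_mulVec x Pᵀ,
        Matrix.vecMul_transpose]
  calc lambdaSorted N k * (x ⬝ᵥ x) ≤ x ⬝ᵥ (N *ᵥ x) := by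
        rw [hW1, hW2, Finset.mul_sum]
        refine Finset.sum_le_sum fun i _ => ?_
        rcases lt_or_ge i k with h | h
        · simp [hWx i h]
        · exact mul_le_mul_of_nonneg_right (mN h) (sq_nonneg _)
    _ = (P *ᵥ x) ⬝ᵥ (M *ᵥ (P *ᵥ x)) := e
    _ ≤ _ := by
        rw [hU1, hU2, Finset.mul_sum]
        refine Finset.sum_le_sum fun i _ => ?_
        rcases lt_or_ge k i with h | h
        · simp [hUx i h]
        · exact mul_le_mul_of_nonneg_right (mM h) (sq_nonneg _)

theorem aux_ratio {n : ℕ} (s : Fin n → ℝ) (hs : ∀ i, 0 < s i) (x : Fin n → ℝ) (hx : x ≠ 0) :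
    ∃ t ∈ Set.Icc (⨅ i, s i) (⨆ i, s i), 0 < x ⬝ᵥ x ∧
      ((Matrix.diagonal fun i => Real.sqrt (s i)) *ᵥ x) ⬝ᵥ
        ((Matrix.diagonal fun i => Real.sqrt (s i)) *ᵥ x) = t * (x ⬝ᵥ x) := by
  have h0 : 0 < x ⬝ᵥ x := by
    have h1 : 0 ≤ x ⬝ᵥ x := Finset.sum_nonneg fun i _ => mul_self_nonneg _
    exact lt_of_le_of_ne h1 fun h => hx (dotProduct_self_eq_zero.1 h.symm)
  have e : ((Matrix.diagonal fun i => Real.sqrt (s i)) *ᵥ x) ⬝ᵥ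
        ((Matrix.diagonal fun i => Real.sqrt (s i)) *ᵥ x) = ∑ i, s i * (x i * x i) := by
    refine Finset.sum_congr rfl fun i _ => ?_
    rw [Matrix.mulVec_diagonal]
    have := Real.mul_self_sqrt (hs i).le
    linear_combination (x i * x i) * this
  rw [e]
  refine ⟨(∑ i, s i * (x i * x i)) / (x ⬝ᵥ x), ⟨?_, ?_⟩, h0, by field_simp⟩
  · rw [le_div_iff₀ h0, dotProduct, Finset.mul_sum]
    exact Finset.sum_le_sum fun i _ => mul_le_mul_of_nonneg_right
      (ciInf_le (Set.finite_range s).bddBelow i) (mul_self_nonneg _)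
  · rw [div_le_iff₀ h0, dotProduct, Finset.mul_sum]
    exact Finset.sum_le_sum fun i _ => mul_le_mul_of_nonneg_right
      (le_ciSup (Set.finite_range s).bddAbove i) (mul_self_nonneg _)

/-- Lemma 2, from Ostrowski's theorem: for `A` symmetric and
`D, S` positive diagonal, `B = DA`, the matrices `BS`, `SB` and `S^{1/2}BS^{1/2}`
all share the characteristic polynomial of the symmetric matrix
`S^{1/2}D^{1/2}AD^{1/2}S^{1/2}` (and `B` that of `D^{1/2}AD^{1/2}`), and each
sorted eigenvalue satisfies `λ_k(S^{1/2}D^{1/2}AD^{1/2}S^{1/2}) = θ_k·λ_k(D^{1/2}AD^{1/2})`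
for some `θ_k ∈ [min_i s_i, max_i s_i]`. -/
theorem stmt_15 {n : ℕ} (A : Matrix (Fin n) (Fin n) ℝ) (hA : A.IsSymm)
    (d s : Fin n → ℝ) (hd : ∀ i, 0 < d i) (hs : ∀ i, 0 < s i)
    (B : Matrix (Fin n) (Fin n) ℝ) (hB : B = Matrix.diagonal d * A)
    (Dh Sh : Matrix (Fin n) (Fin n) ℝ)
    (hDh : Dh = Matrix.diagonal fun i => Real.sqrt (d i))
    (hSh : Sh = Matrix.diagonal fun i => Real.sqrt (s i)) :
    B.charpoly = (Dh * A * Dh).charpoly ∧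
    (B * Matrix.diagonal s).charpoly = (Sh * Dh * A * Dh * Sh).charpoly ∧
    (Matrix.diagonal s * B).charpoly = (Sh * Dh * A * Dh * Sh).charpoly ∧
    (Sh * B * Sh).charpoly = (Sh * Dh * A * Dh * Sh).charpoly ∧
    ∀ k : Fin n, ∃ θ ∈ Set.Icc (⨅ i, s i) (⨆ i, s i),
      lambdaSorted (Sh * Dh * A * Dh * Sh) k = θ * lambdaSorted (Dh * A * Dh) k := by
  have hDD : Matrix.diagonal d = Dh * Dh := by
    rw [hDh, Matrix.diagonal_mul_diagonal]
    congr 1; funext i; exact (Real.mul_self_sqrt (hd i).le).symm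
  have hSS : Matrix.diagonal s = Sh * Sh := by
    rw [hSh, Matrix.diagonal_mul_diagonal]
    congr 1; funext i; exact (Real.mul_self_sqrt (hs i).le).symm
  have hc : Dh * Sh = Sh * Dh := by
    rw [hDh, hSh, Matrix.diagonal_mul_diagonal, Matrix.diagonal_mul_diagonal]
    congr 1; funext i; exact mul_comm _ _
  have hDt : Dhᵀ = Dh := by rw [hDh, Matrix.diagonal_transpose]
  have hSt : Shᵀ = Sh := by rw [hSh, Matrix.diagonal_transpose]
  have h4 : (Sh * B * Sh).charpoly = (Sh * Dh * A * Dh * Sh).charpoly := by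
    have e1 : Sh * B * Sh = Dh * (Sh * Dh * A * Sh) := by
      rw [hB, hDD]; simp only [← Matrix.mul_assoc]; rw [hc]
    rw [e1, Matrix.charpoly_mul_comm, Matrix.mul_assoc _ Sh Dh, ← hc, ← Matrix.mul_assoc]
  have h3 : (Matrix.diagonal s * B).charpoly = (Sh * Dh * A * Dh * Sh).charpoly := by
    rw [← h4, hSS, Matrix.mul_assoc, Matrix.charpoly_mul_comm]
  refine ⟨?_, ?_, h3, h4, ?_⟩
  · rw [hB, hDD, Matrix.mul_assoc, Matrix.charpoly_mul_comm]
  · rw [Matrix.charpoly_mul_comm, h3]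
  intro k
  have hAt : Aᵀ = A := hA
  have hM : (Dh * A * Dh).IsHermitian := by
    simp [Matrix.IsHermitian, Matrix.conjTranspose_eq_transpose_of_trivial,
      Matrix.transpose_mul, hDt, hAt, Matrix.mul_assoc]
  have hN : (Sh * Dh * A * Dh * Sh).IsHermitian := by
    simp [Matrix.IsHermitian, Matrix.conjTranspose_eq_transpose_of_trivial,
      Matrix.transpose_mul, hDt, hSt, hAt, Matrix.mul_assoc]
  obtain ⟨Q, hQ⟩ : ∃ Q, Q = Matrix.diagonal fun i => (Real.sqrt (s i))⁻¹ := ⟨_, rfl⟩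
  have hne : ∀ i, Real.sqrt (s i) ≠ 0 := fun i => (Real.sqrt_pos.2 (hs i)).ne'
  have hSQ : Sh * Q = 1 := by
    rw [hSh, hQ, Matrix.diagonal_mul_diagonal, ← Matrix.diagonal_one]
    congr 1; funext i; exact mul_inv_cancel₀ (hne i)
  have hQS : Q * Sh = 1 := mul_eq_one_comm.1 hSQ
  have hQt : Qᵀ = Q := by rw [hQ, Matrix.diagonal_transpose]
  obtain ⟨x, hx0, hx⟩ := aux_key _ _ Sh hM hN (by rw [hSt]; simp only [Matrix.mul_assoc]) k
  obtain ⟨y, hy0, hy⟩ := aux_key _ _ Q hN hM (by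
    rw [hQt]; simp only [Matrix.mul_assoc]; rw [hSQ, Matrix.mul_one, ← Matrix.mul_assoc Q Sh, hQS,
      Matrix.one_mul]) k
  have hy' : Sh *ᵥ (Q *ᵥ y) = y := by rw [Matrix.mulVec_mulVec, hSQ, Matrix.one_mulVec]
  have hz0 : Q *ᵥ y ≠ 0 := fun h => hy0 (by rw [← hy', h, Matrix.mulVec_zero])
  obtain ⟨t, ht, hxp, htx⟩ := aux_ratio s hs x hx0
  obtain ⟨r, hr, hzp, hrz⟩ := aux_ratio s hs _ hz0
  rw [← hSh] at htx hrz
  rw [hy'] at hrz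
  rw [htx] at hx
  rw [hrz] at hy
  generalize lambdaSorted (Sh * Dh * A * Dh * Sh) k = μ at *
  generalize lambdaSorted (Dh * A * Dh) k = l at *
  have h1 : μ ≤ t * l := by
    refine le_of_mul_le_mul_right ?_ hxp
    linarith
  have h2 : r * l ≤ μ := by
    refine le_of_mul_le_mul_right ?_ hzp
    linarith
  rcases lt_trichotomy l 0 with hl | hl | hl
  · refine ⟨μ / l, ⟨ht.1.trans ?_, le_trans ?_ hr.2⟩, (div_mul_cancel₀ _ hl.ne).symm⟩
    · rwa [le_div_iff_of_neg hl]
    · rwa [div_le_iff_of_neg hl]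
  · subst hl
    exact ⟨t, ht, by linarith⟩
  · refine ⟨μ / l, ⟨hr.1.trans ?_, le_trans ?_ ht.2⟩, by field_simp⟩
    · rwa [le_div_iff₀ hl]
    · rwa [div_le_iff₀ hl]
end
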